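/- arXiv:1211.3341 — 8 statements merged into one kernel-verified Lean document; each statement's English description precedes it below -/
import Mathlib

section
/- Let A be a measurable 3-sum-free subset of the interval [0,1]. Then the Lebesgue measure of A satisfies μ(A) ≤ 77/177. -/
open MeasureTheory Set
open scoped Pointwise

/-- distribution function of a set -/
noncomputable def Gd (A : Set ℝ) (x : ℝ) : ℝ := volume.real (A ∩ Iic x)

lemma fin_sub {A : Set ℝ} (hA : A ⊆ Icc (0 : ℝ) 1) {S : Set ℝ} (hS : S ⊆ A) : volume S ≠ ⊤ :=
  ((measure_mono (hS.trans hA)).trans_lt (by simp)).ne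

lemma Gd_sub {A : Set ℝ} (hA : A ⊆ Icc (0 : ℝ) 1) (hm : MeasurableSet A) {p q : ℝ} (h : p ≤ q) :
    volume.real (A ∩ Ioc p q) = Gd A q - Gd A p := by
  unfold Gd
  have : A ∩ Iic q = (A ∩ Iic p) ∪ (A ∩ Ioc p q) := by
    rw [← inter_union_distrib_left, Iic_union_Ioc_eq_Iic h]
  rw [this, measureReal_union _ (hm.inter measurableSet_Ioc)
    (fin_sub hA inter_subset_left) (fin_sub hA inter_subset_left)]
  · ring
  · rw [disjoint_left]
    rintro x ⟨_, hx⟩ ⟨_, hx'⟩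
    exact absurd hx (not_le.mpr hx'.1)

lemma Gd_mono {A : Set ℝ} (hA : A ⊆ Icc (0 : ℝ) 1) (hm : MeasurableSet A) {p q : ℝ} (h : p ≤ q) :
    Gd A p ≤ Gd A q := by
  have := Gd_sub hA hm h
  have h2 : 0 ≤ volume.real (A ∩ Ioc p q) := measureReal_nonneg
  linarith

lemma Gd_lip {A : Set ℝ} (hA : A ⊆ Icc (0 : ℝ) 1) (hm : MeasurableSet A) {p q : ℝ} (h : p ≤ q) :
    Gd A q - Gd A p ≤ q - p := by
  rw [← Gd_sub hA hm h]
  have : volume.real (A ∩ Ioc p q) ≤ volume.real (Ioc p q) :=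
    measureReal_mono inter_subset_right (by simp)
  simpa [h] using this

lemma Gd_gap {A : Set ℝ} (hA : A ⊆ Icc (0 : ℝ) 1) (hm : MeasurableSet A) {p q : ℝ} (h : p ≤ q)
    (he : ∀ x ∈ A, p < x → x < q → False) : Gd A q = Gd A p := by
  have h1 := Gd_sub hA hm h
  have h2 : volume.real (A ∩ Ioc p q) = 0 := by
    have : A ∩ Ioc p q ⊆ {q} := by
      rintro x ⟨hx, h3, h4⟩
      rcases h4.lt_or_eq with h5 | h5
      · exact (he x hx h3 h5).elim
      · exact h5
    have h3 := measureReal_mono (μ := volume) this (by simp)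
    have h4 : volume.real {q} = 0 := by simp [Measure.real]
    exact le_antisymm (h3.trans h4.le) measureReal_nonneg
  linarith

lemma vol_affine (c d : ℝ) (S : Set ℝ) :
    volume.real ((fun x => c * x + d) '' S) = |c| * volume.real S := by
  have : (fun x => c * x + d) '' S = (fun x => x + d) '' (c • S) := by
    rw [← image_smul, image_image]
    rfl
  rw [this]
  simp only [Measure.real]
  rw [image_add_right, measure_preimage_add_right, Measure.addHaar_smul]
  simp

lemma disj_le {A : Set ℝ} (hA : A ⊆ Icc (0 : ℝ) 1) (hm : MeasurableSet A) {p q : ℝ} (h : p ≤ q)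
    {T : Set ℝ} (hT : T ⊆ Icc p q) (hd : Disjoint T A) :
    volume.real T + (Gd A q - Gd A p) ≤ q - p := by
  rw [← Gd_sub hA hm h, ← measureReal_union (hd.mono_right inter_subset_left)
    (hm.inter measurableSet_Ioc) ((measure_mono hT).trans_lt (by simp)).ne
    (fin_sub hA inter_subset_left)]
  have : volume.real (T ∪ A ∩ Ioc p q) ≤ volume.real (Icc p q) :=
    measureReal_mono (union_subset hT (inter_subset_right.trans Ioc_subset_Icc_self)) (by simp)
  simpa [h] using this

/-- 3-sum-free -/
def SF (A : Set ℝ) : Prop := ∀ x ∈ A, ∀ y ∈ A, ∀ z ∈ A, x + y ≠ 3 * z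

lemma piece {A : Set ℝ} (hA : A ⊆ Icc (0 : ℝ) 1) (hm : MeasurableSet A) (hs : SF A)
    {y : ℝ} (hy : y ∈ A) {p q : ℝ} (h : p ≤ q) :
    3 * (Gd A q - Gd A p) + (Gd A (3 * q - y) - Gd A (3 * p - y)) ≤ 3 * (q - p) := by
  have := disj_le hA hm (p := 3 * p - y) (q := 3 * q - y) (by linarith)
    (T := (fun x => 3 * x + (-y)) '' (A ∩ Ioc p q)) ?_ ?_
  · rw [vol_affine, Gd_sub hA hm h] at this
    rw [abs_of_pos (by norm_num)] at this
    linarith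
  · rintro _ ⟨x, ⟨_, h1, h2⟩, rfl⟩
    constructor <;> simp only <;> linarith
  · rw [disjoint_left]
    rintro _ ⟨x, ⟨h0, h1, h2⟩, rfl⟩ h3
    exact hs _ h3 _ hy _ h0 (by ring)

lemma pigeon {A : Set ℝ} (hA : A ⊆ Icc (0 : ℝ) 1) (hm : MeasurableSet A) {u v : ℝ} (h : u ≤ v)
    (hg : (v - u) / 2 < Gd A v - Gd A u) : ∃ x ∈ A, ∃ y ∈ A, x + y = u + v := by
  by_contra! hc
  have := disj_le hA hm h
    (T := (fun x => (-1) * x + (u + v)) '' (A ∩ Ioc u v)) ?_ ?_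
  · rw [vol_affine, Gd_sub hA hm h] at this
    simp at this
    linarith
  · rintro _ ⟨x, ⟨_, h1, h2⟩, rfl⟩
    constructor <;> simp only <;> linarith
  · rw [disjoint_left]
    rintro _ ⟨x, ⟨h0, h1, h2⟩, rfl⟩ h3
    exact hc _ h3 _ h0 (by ring)

lemma Gd_least {A : Set ℝ} {a x : ℝ} (ha : IsLeast A a) (hx : x ≤ a) : Gd A x = 0 := by
  have : A ∩ Iic x ⊆ {a} := by
    rintro z ⟨h1, h2⟩
    exact le_antisymm (le_trans h2 hx) (ha.2 h1)
  have h3 := measureReal_mono (μ := volume) this (by simp)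
  have h4 : volume.real {a} = 0 := by simp [Measure.real]
  exact le_antisymm (h3.trans h4.le) measureReal_nonneg

lemma Gd_one {A : Set ℝ} (hA : A ⊆ Icc (0 : ℝ) 1) : Gd A 1 = volume.real A := by
  unfold Gd
  rw [inter_eq_left.mpr]
  exact fun x hx => (hA hx).2

/-- key lemma -/
lemma key {A : Set ℝ} (hA : A ⊆ Icc (0 : ℝ) 1) (hc : IsCompact A) (hs : SF A) (h1 : (1:ℝ) ∈ A)
    {a : ℝ} (ha : IsLeast A a) (hM : 1 / 4 ≤ Gd A 1 - Gd A (2/3)) :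
    Gd A 1 - Gd A (2/9 + a/3) ≤ 1/3 := by
  have hm := hc.measurableSet
  have mono := fun {p q : ℝ} (h : p ≤ q) => Gd_mono hA hm h
  have lip := fun {p q : ℝ} (h : p ≤ q) => Gd_lip hA hm h
  have pc := fun {y : ℝ} (hy : y ∈ A) {p q : ℝ} (h : p ≤ q) => piece hA hm hs hy h
  have ha0 : 0 ≤ a := (hA ha.1).1
  have ha1 : a ≤ 1 := (hA ha.1).2
  have hcont : Continuous (Gd A) := by
    have : LipschitzWith 1 (Gd A) := by
      apply LipschitzWith.of_le_add_mul
      intro x y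
      rcases le_total x y with h | h
      · have := mono h
        have : 0 ≤ dist x y := dist_nonneg
        simp; linarith
      · have := lip h
        rw [Real.dist_eq, abs_of_nonneg (by linarith)]
        simp; linarith
    exact this.continuous
  set w := 1/3 - (Gd A 1 - Gd A (2/3)) with hw
  have hw0 : 0 ≤ w := by have := lip (p := 2/3) (q := 1) (by norm_num); linarith
  -- the scale l
  obtain ⟨l, ⟨⟨hl0, hl1⟩, hl2⟩, hlmax⟩ : ∃ l, IsGreatest
      (Icc (0:ℝ) (1/3) ∩ {l | Gd A 1 - Gd A (1 - l) ≤ l / 2}) l := by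
    apply IsCompact.exists_isGreatest
    · apply isCompact_Icc.inter_right
      exact isClosed_le (by fun_prop) (by fun_prop)
    · exact ⟨0, by simp⟩
  simp only [mem_ofPred_eq] at hl2
  have hl2w : l ≤ 2 * w := by
    have := lip (p := 2/3) (q := 1 - l) (by linarith)
    linarith
  set q := 4/9 + 2*w/3 with hq
  have hq2 : q ≤ 1/2 := by linarith
  have hgap : ∀ x ∈ A, q < x → x < (2 - l)/3 → False := by
    intro x hx hx1 hx2
    obtain ⟨y, hy, z, hz, hyz⟩ := pigeon hA hm (u := 3*x - 1) (v := 1) (by linarith) (by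
      by_cases h : 2 - 3*x ≤ 1/3
      · by_contra hcon
        have : 2 - 3*x ≤ l := hlmax ⟨⟨by linarith, h⟩, by
          simp only [mem_ofPred_eq]
          rw [show 1 - (2 - 3*x) = 3*x-1 by ring]; linarith⟩
        linarith
      · have := mono (p := 3*x-1) (q := 2/3) (by linarith)
        linarith)
    exact hs y hy z hz x hx (by linarith)
  have hG1 : Gd A ((2-l)/3) = Gd A q := Gd_gap hA hm (by linarith) hgap
  -- top piece
  have htop := pc h1 (p := (2-l)/3) (q := 2/3) (by linarith)
  rw [show 3 * (2/3:ℝ) - 1 = 1 by norm_num, show 3 * ((2-l)/3) - 1 = 1 - l by ring] at htop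
  set t := 2/9 + a/3 with ht
  have hNl : 0 ≤ ((1 - l - 2/3) - (Gd A (1-l) - Gd A (2/3))) := by
    have := lip (p := 2/3) (q := 1-l) (by linarith)
    linarith
  suffices hsuf : q < t ∨ 3 * (Gd A q - Gd A t) ≤ 2 * w + ((1 - l - 2/3) - (Gd A (1-l) - Gd A (2/3))) by
    rcases hsuf with h | h
    · have := mono h.le
      linarith
    · linarith
  by_cases hqt : q < t
  · exact Or.inl hqt
  right
  push Not at hqt
  by_cases hne : (A ∩ Icc 0 q).Nonempty
  swap
  · have : Gd A q = Gd A t := Gd_gap hA hm hqt (fun x hx h2 h3 => hne ⟨x, hx, by linarith, h3.le⟩)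
    linarith
  obtain ⟨f, ⟨hfA, hf0, hfq⟩, hfmax⟩ := (hc.inter_right isClosed_Icc).exists_isGreatest hne
  have hGf : Gd A q = Gd A f := Gd_gap hA hm hfq
    (fun x hx h2 h3 => absurd (hfmax ⟨hx, (hA hx).1, h3.le⟩) (not_le.mpr h2))
  have hpa := pc ha.1 (p := t) (q := (1+a)/3) (by linarith)
  rw [show 3 * ((1 + a)/3) - a = 1 by ring, show 3 * t - a = 2/3 by rw [ht]; ring] at hpa
  by_cases hf1 : f ≤ 1/3 + a
  · by_cases hf2 : f ≤ (1+a)/3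
    · have := mono hf2
      linarith
    · push Not at hf2
      have hpf := pc hfA hf2.le
      have e1 := lip (p := 2/3) (q := 3 * ((1 + a)/3) - f) (by linarith)
      have e2 := lip (p := 3 * f - f) (q := 1) (by linarith)
      linarith
  push Not at hf1
  obtain ⟨f2, ⟨hf2A, hf20, hf2q⟩, hf2max⟩ :=
    (hc.inter_right (isClosed_Icc (a := 0) (b := 1/3 + a))).exists_isGreatest
      ⟨a, ha.1, ha0, by linarith⟩
  obtain ⟨f3, ⟨hf3A, hf30, hf3q⟩, hf3max⟩ :=
    (hc.inter_right (isClosed_Icc (a := 1/3 + a) (b := f))).exists_isLeast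
      ⟨f, hfA, hf1.le, le_refl _⟩
  have hg23 : ∀ x ∈ A, f2 < x → x < f3 → False := by
    intro x hx h2 h3
    rcases le_total x (1/3 + a) with h | h
    · exact absurd (hf2max ⟨hx, (hA hx).1, h⟩) (not_le.mpr h2)
    · exact absurd (hf3max ⟨hx, h, by linarith⟩) (not_le.mpr h3)
  set c := (2/3 + f)/3 with hcdef
  have hpf := pc hfA (p := c) (q := f) (by linarith)
  rw [show 3 * c - f = 2/3 by rw [hcdef]; ring] at hpf
  have e2 := lip (p := 3 * f - f) (q := 1) (by linarith)
  -- middle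
  suffices hmid : 3 * (Gd A c - Gd A ((1+a)/3)) ≤ ((1 - l - 2/3) - (Gd A (1-l) - Gd A (2/3))) by
    linarith
  by_cases hca : c ≤ (1+a)/3
  · have := mono hca
    linarith
  push Not at hca
  -- bound via f2
  by_cases hc2 : c ≤ f2
  · have hp2 := pc hf2A hca.le
    have e3 := lip (p := 2/3) (q := 3 * ((1 + a)/3) - f2) (by linarith)
    have e4 := lip (p := 3 * c - f2) (q := 1 - l) (by linarith)
    linarith
  push Not at hc2
  -- part below f2
  have hlow : 3 * (Gd A f2 - Gd A ((1+a)/3)) ≤ max 0 ((2*f2 - 2/3) - (Gd A (2*f2) - Gd A (2/3))) := by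
    by_cases h : f2 ≤ (1+a)/3
    · have := mono h
      exact le_trans (by linarith) (le_max_left _ _)
    · push Not at h
      have hp2 := pc hf2A h.le
      have e3 := lip (p := 2/3) (q := 3 * ((1 + a)/3) - f2) (by linarith)
      rw [show 3 * f2 - f2 = 2 * f2 by ring] at hp2
      exact le_trans (by linarith) (le_max_right _ _)
  by_cases hc3 : c ≤ f3
  · have hG : Gd A c = Gd A f2 := Gd_gap hA hm hc2.le (fun x hx h2 h3 => hg23 x hx h2 (by linarith))
    rw [hG]
    refine hlow.trans (max_le hNl ?_)
    have e4 := lip (p := 2 * f2) (q := 1 - l) (by linarith)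
    linarith
  push Not at hc3
  have h23 : f2 ≤ f3 := by linarith
  have hG : Gd A f3 = Gd A f2 := Gd_gap hA hm h23 hg23
  have hp3 := pc hf3A hc3.le
  rw [show 3 * f3 - f3 = 2 * f3 by ring] at hp3
  have e4 := lip (p := 3 * c - f3) (q := 1 - l) (by linarith)
  have e5 : max 0 ((2*f2 - 2/3) - (Gd A (2*f2) - Gd A (2/3))) ≤ (2*f3 - 2/3) - (Gd A (2*f3) - Gd A (2/3)) := by
    apply max_le
    · have := lip (p := 2/3) (q := 2 * f3) (by linarith)
      linarith
    · have := lip (p := 2*f2) (q := 2 * f3) (by linarith)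
      linarith
  linarith

lemma smallB {A : Set ℝ} (hA : A ⊆ Icc (0 : ℝ) 1) (hc : IsCompact A) (hs : SF A)
    {a : ℝ} (ha : IsLeast A a) {t : ℝ} (hat : a ≤ t) :
    Gd A t ≤ t - a ∧ (5 * t / 9 ≤ a → Gd A t ≤ t / 3) ∧ (a ≤ 5 * t / 9 → Gd A t ≤ 8 * t / 9 - a) := by
  have hm := hc.measurableSet
  have lip := fun {p q : ℝ} (h : p ≤ q) => Gd_lip hA hm h
  have ha0 : 0 ≤ a := (hA ha.1).1
  obtain ⟨f, ⟨hfA, hf0, hfq⟩, hfmax⟩ :=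
    (hc.inter_right (isClosed_Icc (a := a) (b := t))).exists_isGreatest
      ⟨a, ha.1, le_refl _, hat⟩
  have hGf : Gd A t = Gd A f := Gd_gap hA hm hfq
    (fun x hx h2 h3 => absurd (hfmax ⟨hx, ha.2 hx, h3.le⟩) (not_le.mpr h2))
  have hGa : Gd A a = 0 := Gd_least ha le_rfl
  have b1 : Gd A f ≤ f - a := by have := lip hf0; linarith
  have b2 : ∀ y, 2 * f / 3 ≤ y → y ≤ f → 3 * a - f ≤ y → Gd A f ≤ f - a - (f - y)/3 := by
    intro y h1 h2 h3
    have hp := piece hA hm hs hfA (p := (y + f)/3) (q := 2 * f / 3) (by linarith)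
    rw [show 3 * (2 * f / 3) - f = f by ring, show 3 * ((y+f)/3) - f = y by ring] at hp
    have e1 := lip h1
    have e2 := lip h2
    have e3 := lip (p := a) (q := (y+f)/3) (by linarith)
    linarith
  rw [hGf]
  refine ⟨by linarith, ?_, ?_⟩
  · intro h
    by_cases h2 : a ≤ 2 * f / 3
    · have := b2 (3 * a - f) (by linarith) (by linarith) le_rfl
      linarith
    · linarith
  · intro h
    by_cases h2 : a ≤ 5 * f / 9
    · have := b2 (2 * f / 3) (by linarith) (by linarith) (by linarith)
      linarith
    · by_cases h2 : a ≤ 2 * f / 3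
      · have := b2 (3 * a - f) (by linarith) (by linarith) le_rfl
        linarith
      · linarith

/-- counting function -/
def cnt (S : Finset ℕ) (m : ℕ) : ℕ := (S ∩ Finset.Icc 1 m).card

lemma cnt_mono {S T : Finset ℕ} {m : ℕ} (h : ∀ x ∈ S, x ≤ m → x ∈ T) : cnt S m ≤ cnt T m := by
  apply Finset.card_le_card
  intro x hx
  simp only [Finset.mem_inter, Finset.mem_Icc] at hx ⊢
  exact ⟨h x hx.1 hx.2.2, hx.2⟩

lemma cnt_shift {S : Finset ℕ} (h0 : 0 ∈ S) {b r : ℕ} (hb : 1 ≤ b)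
    (h : ∀ a ∈ S, a ≤ r → b + a ∈ S) : cnt S (b - 1) + 1 + cnt S r ≤ cnt S (b + r) := by
  unfold cnt
  have e : ((S ∩ Finset.Icc 1 (b-1)) ∪ ({b} ∪ (S ∩ Finset.Icc 1 r).image (b + ·))).card
      = (S ∩ Finset.Icc 1 (b-1)).card + (1 + (S ∩ Finset.Icc 1 r).card) := by
    rw [Finset.card_union_of_disjoint, Finset.card_union_of_disjoint, Finset.card_singleton,
      Finset.card_image_of_injective _ (add_right_injective b)]
    · rw [Finset.disjoint_left]
      intro x hx
      simp only [Finset.mem_singleton, Finset.mem_image, Finset.mem_inter, Finset.mem_Icc] at hx ⊢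
      rintro ⟨y, hy, rfl⟩
      omega
    · rw [Finset.disjoint_left]
      intro x hx
      simp only [Finset.mem_union, Finset.mem_singleton, Finset.mem_image, Finset.mem_inter,
        Finset.mem_Icc] at hx ⊢
      rintro (h1 | ⟨y, hy, rfl⟩) <;> omega
  rw [add_assoc, ← e]
  apply Finset.card_le_card
  intro x hx
  simp only [Finset.mem_union, Finset.mem_singleton, Finset.mem_image, Finset.mem_inter,
        Finset.mem_Icc] at hx ⊢
  rcases hx with h1 | rfl | ⟨y, hy, rfl⟩
  · exact ⟨h1.1, by omega⟩
  · exact ⟨h 0 h0 (by omega), by omega⟩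
  · exact ⟨h y hy.1 hy.2.2, by omega⟩

lemma mann (γ : ℝ) (hγ : γ ≤ 1) : ∀ n : ℕ, ∀ k : ℕ, ∀ A B : Finset ℕ, B.card = k → 0 ∈ A → 0 ∈ B →
    (∀ m ≤ n, γ * m ≤ cnt A m + cnt B m) → γ * n ≤ cnt (A + B) n := by
  intro n
  induction n using Nat.strong_induction_on with
  | _ n ihn =>
  intro k
  induction k using Nat.strong_induction_on with
  | _ k ihk =>
  intro A B hk hA hB hd
  by_cases hex : ∃ e, e ∈ A ∧ ∃ b ∈ B, b + e ≤ n ∧ b + e ∉ A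
  · classical
    obtain ⟨heA, b0, hb0, hb0n, hb0A⟩ := Nat.find_spec hex
    have hmin : ∀ a ∈ A, a < Nat.find hex → ∀ b ∈ B, b + a ≤ n → b + a ∈ A := by
      intro a ha h b hb hba
      by_contra hc
      exact Nat.find_min hex h ⟨ha, b, hb, hba, hc⟩
    generalize Nat.find hex = e at *
    set R := B.filter (fun b => b + e ≤ n ∧ b + e ∉ A) with hR
    have memR : ∀ b, b ∈ R ↔ b ∈ B ∧ b + e ≤ n ∧ b + e ∉ A := by intro b; simp [hR]
    have hR0 : 0 ∉ R := by
      rw [memR]; rintro ⟨_, _, h⟩; simp at h; exact h heA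
    have hRB : R ⊆ B := Finset.filter_subset _ _
    set A' := A ∪ R.image (· + e) with hA'
    set B' := B \ R with hB'
    have hcard : B'.card < k := by
      rw [← hk]
      apply Finset.card_lt_card
      refine ⟨Finset.sdiff_subset, fun h => ?_⟩
      have h1 := h hb0
      rw [hB', Finset.mem_sdiff, memR] at h1
      exact h1.2 ⟨hb0, hb0n, hb0A⟩
    have hmain := ihk _ hcard A' B' rfl (Finset.mem_union_left _ hA)
      (Finset.mem_sdiff.mpr ⟨hB, hR0⟩) ?_
    · refine hmain.trans ?_
      have : cnt (A' + B') n ≤ cnt (A + B) n := by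
        apply cnt_mono
        intro x hx hxn
        rw [Finset.mem_add] at hx
        obtain ⟨y, hy, z, hz, rfl⟩ := hx
        rw [hB', Finset.mem_sdiff, memR] at hz
        rw [hA', Finset.mem_union, Finset.mem_image] at hy
        rcases hy with hy | ⟨b, hb, rfl⟩
        · exact Finset.add_mem_add hy hz.1
        · have hze : z + e ∈ A := by
            by_contra hc
            exact hz.2 ⟨hz.1, by omega, hc⟩
          have := Finset.add_mem_add hze (hRB hb)
          rwa [show z + e + b = b + e + z by ring] at this
      exact_mod_cast this
    · intro m hm
      set D := R.filter (fun b => b ≤ m ∧ m < b + e) with hD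
      have hDm : ∀ b, b ∈ D ↔ b ∈ R ∧ b ≤ m ∧ m < b + e := by intro b; simp [hD]
      have hcA : cnt A' m = cnt A m + (R.filter (fun b => b + e ≤ m)).card := by
        unfold cnt
        rw [← Finset.card_image_of_injective (R.filter (fun b => b + e ≤ m)) (add_left_injective e),
          ← Finset.card_union_of_disjoint]
        · congr 1
          ext x
          simp only [hA', Finset.mem_union, Finset.mem_inter, Finset.mem_image, Finset.mem_Icc,
            Finset.mem_filter]
          constructor
          · rintro ⟨h | ⟨b, hb, rfl⟩, h2⟩
            · exact Or.inl ⟨h, h2⟩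
            · exact Or.inr ⟨b, ⟨hb, h2.2⟩, rfl⟩
          · rintro (⟨h, h2⟩ | ⟨b, ⟨hb, h2⟩, rfl⟩)
            · exact ⟨Or.inl h, h2⟩
            · refine ⟨Or.inr ⟨b, hb, rfl⟩, ?_, h2⟩
              rcases Nat.eq_zero_or_pos b with h | h
              · subst h; exact absurd hb hR0
              · omega
        · rw [Finset.disjoint_left]
          intro x hx hx2
          simp only [Finset.mem_inter, Finset.mem_image, Finset.mem_filter] at hx hx2
          obtain ⟨b, ⟨hb, h2⟩, rfl⟩ := hx2
          exact ((memR b).mp hb).2.2 hx.1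
      have hcB : cnt B m = cnt B' m + ((R.filter (fun b => b + e ≤ m)).card + D.card) := by
        unfold cnt
        rw [hD, ← Finset.card_union_of_disjoint, ← Finset.card_union_of_disjoint]
        · congr 1
          ext x
          simp only [hB', Finset.mem_union, Finset.mem_inter, Finset.mem_sdiff, Finset.mem_Icc,
            Finset.mem_filter]
          constructor
          · rintro ⟨h, h2⟩
            by_cases hx : x ∈ R
            · right
              by_cases h3 : x + e ≤ m
              · exact Or.inl ⟨hx, h3⟩
              · exact Or.inr ⟨hx, h2.2, by omega⟩
            · exact Or.inl ⟨⟨h, hx⟩, h2⟩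
          · have hx0 : x ∈ R → 1 ≤ x := by
              intro h
              rcases Nat.eq_zero_or_pos x with h' | h'
              · subst h'; exact absurd h hR0
              · exact h'
            rintro (⟨⟨h, h1⟩, h2⟩ | ⟨h, h2⟩ | ⟨h, h2⟩)
            · exact ⟨h, h2⟩
            · exact ⟨hRB h, hx0 h, by omega⟩
            · exact ⟨hRB h, hx0 h, by omega⟩
        · rw [Finset.disjoint_left]
          intro x hx hx2
          simp only [hB', Finset.mem_union, Finset.mem_inter, Finset.mem_sdiff, Finset.mem_Icc,
            Finset.mem_filter] at hx hx2
          rcases hx2 with h | h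
          · exact hx.1.2 h.1
          · exact hx.1.2 h.1
        · rw [Finset.disjoint_left]
          intro x hx hx2
          simp only [Finset.mem_filter] at hx hx2
          omega
      by_cases hDne : D.Nonempty
      · obtain ⟨b1, hb1, hb1min⟩ : ∃ b1 ∈ D, ∀ b ∈ D, b1 ≤ b :=
          ⟨D.min' hDne, D.min'_mem hDne, fun b hb => D.min'_le b hb⟩
        rw [hDm] at hb1
        have hb1pos : 1 ≤ b1 := by
          rcases Nat.eq_zero_or_pos b1 with h' | h'
          · subst h'; exact absurd hb1.1 hR0
          · exact h'
        obtain ⟨r, rfl⟩ := Nat.exists_eq_add_of_le hb1.2.1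
        have hb1R := (memR _).mp hb1.1
        have h1 : cnt A (b1 - 1) + 1 + cnt A r ≤ cnt A (b1 + r) := by
          apply cnt_shift hA hb1pos
          intro a ha har
          exact hmin a ha (by omega) b1 (hRB hb1.1) (by omega)
        have h2 : γ * r ≤ cnt (A + B) r :=
          ihn r (by omega) _ A B rfl hA hB (fun m' hm' => hd m' (by omega))
        have h3 : cnt (A + B) r ≤ cnt A r := by
          apply cnt_mono
          intro x hx hxr
          rw [Finset.mem_add] at hx
          obtain ⟨y, hy, z, hz, rfl⟩ := hx
          rw [add_comm]
          exact hmin y hy (by omega) z hz (by omega)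
        have h4 : cnt B (b1 - 1) + D.card ≤ cnt B (b1 + r) := by
          unfold cnt
          rw [← Finset.card_union_of_disjoint]
          · apply Finset.card_le_card
            intro x hx
            rw [Finset.mem_union, hDm] at hx
            simp only [Finset.mem_inter, Finset.mem_Icc] at hx ⊢
            rcases hx with h | h
            · exact ⟨h.1, by omega⟩
            · exact ⟨hRB h.1, by have := hb1min x ((hDm x).mpr h); omega⟩
          · rw [Finset.disjoint_left]
            intro x hx hx2
            have := hb1min x hx2
            simp only [Finset.mem_inter, Finset.mem_Icc] at hx
            omega
        have h5 := hd (b1 - 1) (by omega)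
        have h6 : cnt A (b1-1) + cnt B (b1 - 1) + cnt (A+B) r + 1 ≤ cnt A' (b1 + r) + cnt B' (b1 + r) := by
          omega
        have h7 : (cnt A (b1-1) + cnt B (b1 - 1) + cnt (A+B) r + 1 : ℝ) ≤ cnt A' (b1 + r) + cnt B' (b1 + r) := by
          exact_mod_cast h6
        push_cast [Nat.cast_sub hb1pos] at h5 ⊢
        nlinarith
      · rw [Finset.not_nonempty_iff_eq_empty] at hDne
        rw [hDne] at hcB
        have h5 := hd m hm
        have h6 : cnt A m + cnt B m = cnt A' m + cnt B' m := by
          simp at hcB; omega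
        have h7 : (cnt A m + cnt B m : ℝ) = cnt A' m + cnt B' m := by exact_mod_cast h6
        linarith
  · push Not at hex
    have hAB : (cnt A n : ℝ) ≤ cnt (A + B) n := by
      have : cnt A n ≤ cnt (A + B) n := cnt_mono (fun x hx _ => by
        simpa using Finset.add_mem_add hx hB)
      exact_mod_cast this
    by_cases hBn : (B ∩ Finset.Icc 1 n).Nonempty
    · obtain ⟨b1, hb1, hb1min⟩ : ∃ b1 ∈ (B ∩ Finset.Icc 1 n), ∀ b ∈ (B ∩ Finset.Icc 1 n), b1 ≤ b :=
          ⟨_, Finset.min'_mem _ hBn, fun b hb => Finset.min'_le _ b hb⟩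
      simp only [Finset.mem_inter, Finset.mem_Icc] at hb1 hb1min
      obtain ⟨r, rfl⟩ := Nat.exists_eq_add_of_le hb1.2.2
      have h1 : cnt A (b1 - 1) + 1 + cnt A r ≤ cnt A (b1 + r) := by
        apply cnt_shift hA hb1.2.1
        intro a ha har
        exact hex a ha b1 hb1.1 (by omega)
      have h2 : γ * r ≤ cnt (A + B) r :=
          ihn r (by omega) _ A B rfl hA hB (fun m' hm' => hd m' (by omega))
      have h3 : cnt (A + B) r ≤ cnt A r := by
        apply cnt_mono
        intro x hx hxr
        rw [Finset.mem_add] at hx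
        obtain ⟨y, hy, z, hz, rfl⟩ := hx
        rw [add_comm]
        exact hex y hy z hz (by omega)
      have h4 : cnt B (b1 - 1) = 0 := by
        unfold cnt
        rw [Finset.card_eq_zero, Finset.eq_empty_iff_forall_notMem]
        intro x hx
        simp only [Finset.mem_inter, Finset.mem_Icc] at hx
        have := hb1min x ⟨hx.1, by omega⟩
        omega
      have h5 := hd (b1 - 1) (by omega)
      rw [h4] at h5
      have h7 : (cnt A (b1-1) + cnt (A+B) r + 1 : ℝ) ≤ cnt A (b1 + r) := by
        exact_mod_cast (show cnt A (b1-1) + cnt (A+B) r + 1 ≤ cnt A (b1 + r) by omega)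
      push_cast [Nat.cast_sub hb1.2.1] at h5 ⊢
      nlinarith
    · have h0 : cnt B n = 0 := by
        unfold cnt
        rw [Finset.card_eq_zero]
        exact Finset.not_nonempty_iff_eq_empty.mp hBn
      have := hd n le_rfl
      rw [h0] at this
      push_cast at this
      linarith

lemma mann_step {Y : Set ℝ} (hY0 : 0 ∈ Y) (hYc : IsCompact Y) (hYp : Y ⊆ Ici 0) {X κ κ' : ℝ} (hX : 0 < X)
    (hκ0 : 0 ≤ κ) (hκ' : κ' ≤ 1/2) (hd : ∀ x, 0 ≤ x → x ≤ X → κ * x ≤ volume.real (Y ∩ Icc 0 x))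
    (n0 : ℕ) (hn0 : 1 ≤ (κ - κ') * n0) (N : ℕ) :
    2 * κ' * (N * (X / (N + 1))) ≤
      volume.real (Metric.cthickening ((2 * n0 + 3) * (X / (N + 1))) (Y + Y) ∩ Icc 0 X) := by
  classical
  set h := X / (N + 1 : ℝ) with hh
  have hN : (0:ℝ) < N + 1 := by positivity
  have hhp : 0 < h := by positivity
  have hXh : X = (N + 1) * h := by rw [hh]; field_simp
  set S := (Finset.range (N+1)).filter (fun k => k ≤ n0 ∨ (Y ∩ Icc (k * h) ((k + 1) * h)).Nonempty) with hS
  have memS : ∀ k, k ∈ S ↔ k < N + 1 ∧ (k ≤ n0 ∨ (Y ∩ Icc (k * h) ((k + 1) * h)).Nonempty) := by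
    intro k; simp [hS]
  have h0S : 0 ∈ S := by rw [memS]; simp
  have hdens : ∀ m ≤ N, κ' * m ≤ cnt S m := by
    intro m hm
    rcases le_or_gt m n0 with hmn | hmn
    · have : m ≤ cnt S m := by
        unfold cnt
        rw [Finset.inter_eq_right.mpr]
        · simp
        · intro x hx
          rw [Finset.mem_Icc] at hx
          rw [memS]
          exact ⟨by omega, by left; omega⟩
      have h1 : (m:ℝ) ≤ cnt S m := by exact_mod_cast this
      have h2 : (0:ℝ) ≤ m := by positivity
      nlinarith
    · have hmN : (m:ℝ) ≤ N := by exact_mod_cast hm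
      have h1 := hd ((m + 1) * h) (by positivity) (by rw [hXh]; gcongr)
      have hsub : Y ∩ Icc 0 ((m+1) * h) ⊆ ⋃ k ∈ (insert 0 (S ∩ Finset.Icc 1 m)), Icc ((k:ℝ) * h) ((k + 1) * h) := by
        rintro y ⟨hy, hy0, hy1⟩
        have hfl : ∃ k : ℕ, k ≤ m ∧ k * h ≤ y ∧ y ≤ (k + 1) * h := by
          by_cases hlast : (m:ℝ) * h ≤ y
          · exact ⟨m, le_rfl, hlast, hy1⟩
          · refine ⟨⌊y / h⌋₊, ?_, ?_, ?_⟩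
            · push Not at hlast
              apply Nat.floor_le_of_le
              rw [div_le_iff₀ hhp]; exact hlast.le
            · rw [← le_div_iff₀ hhp]
              exact Nat.floor_le (by positivity)
            · rw [← div_le_iff₀ hhp]
              exact (Nat.lt_floor_add_one _).le
        obtain ⟨k, hk, hk1, hk2⟩ := hfl
        rw [mem_iUnion₂]
        refine ⟨k, ?_, hk1, hk2⟩
        rw [Finset.mem_insert, Finset.mem_inter, memS, Finset.mem_Icc]
        rcases Nat.eq_zero_or_pos k with h | h
        · exact Or.inl h
        · exact Or.inr ⟨⟨by omega, Or.inr ⟨y, hy, hk1, hk2⟩⟩, h, hk⟩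
      have h2 : volume.real (Y ∩ Icc 0 ((m+1) * h)) ≤ (cnt S m + 1) * h := by
        refine (measureReal_mono hsub ?_).trans ?_
        · refine ((measure_biUnion_finset_le _ _).trans_lt ?_).ne
          exact ENNReal.sum_lt_top.mpr (fun i _ => by simp)
        refine (measureReal_biUnion_finset_le _ _).trans ?_
        have : ∀ k : ℕ, volume.real (Icc ((k:ℝ) * h) ((k + 1) * h)) = h := by
          intro k
          rw [Real.volume_real_Icc_of_le (by nlinarith)]; ring
        simp only [this, Finset.sum_const, nsmul_eq_mul]
        gcongr
        have := Finset.card_insert_le 0 (S ∩ Finset.Icc 1 m)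
        unfold cnt
        exact_mod_cast this
      have h3 : κ * (m + 1) ≤ cnt S m + 1 := by
        have := h1.trans h2
        rw [← mul_assoc] at this
        exact le_of_mul_le_mul_right this hhp
      have hmn' : (n0:ℝ) ≤ m := by exact_mod_cast hmn.le
      have : 0 < κ - κ' := by
        by_contra hcon
        push Not at hcon
        have : (0:ℝ) ≤ n0 := by positivity
        nlinarith
      nlinarith
  have hmann := mann (2 * κ') (by linarith) N _ S S rfl h0S h0S (fun m hm => by
    have := hdens m hm; linarith)
  set C := (S + S) ∩ Finset.Icc 1 N with hC
  have hcell : (⋃ s ∈ C, Ioc ((s:ℝ) * h) ((s + 1) * h)) ⊆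
      Metric.cthickening ((2 * n0 + 3) * h) (Y + Y) ∩ Icc 0 X := by
    intro x hx
    rw [mem_iUnion₂] at hx
    obtain ⟨s, hs, hx1, hx2⟩ := hx
    rw [hC, Finset.mem_inter, Finset.mem_Icc, Finset.mem_add] at hs
    obtain ⟨⟨k, hk, l, hl, rfl⟩, hs1, hs2⟩ := hs
    have near : ∀ k ∈ S, ∃ y ∈ Y, |k * h - y| ≤ (n0 + 1) * h := by
      intro k hk
      rw [memS] at hk
      rcases hk.2 with h1 | ⟨y, hy, hy1, hy2⟩
      · refine ⟨0, hY0, ?_⟩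
        rw [sub_zero, abs_of_nonneg (by positivity)]
        gcongr
        have : (k:ℝ) ≤ n0 := by exact_mod_cast h1
        linarith
      · refine ⟨y, hy, ?_⟩
        have : 0 ≤ (n0:ℝ) * h := by positivity
        rw [abs_le]
        constructor <;> nlinarith
    obtain ⟨y, hy, hy1⟩ := near k hk
    obtain ⟨z, hz, hz1⟩ := near l hl
    push_cast at hx1 hx2
    have hs2' : (k:ℝ) + l ≤ N := by exact_mod_cast hs2
    refine ⟨?_, ?_, ?_⟩
    · refine Metric.mem_cthickening_of_dist_le _ (y + z) _ _ (add_mem_add hy hz) ?_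
      rw [Real.dist_eq]
      rw [abs_le] at hy1 hz1 ⊢
      constructor <;> nlinarith
    · have : 0 ≤ ((k:ℝ) + l) * h := by positivity
      linarith
    · rw [hXh]
      refine hx2.trans ?_
      gcongr
  have hvol : volume.real (⋃ s ∈ C, Ioc ((s:ℝ) * h) ((s + 1) * h)) = C.card * h := by
    rw [measureReal_biUnion_finset ?_ ?_ (fun _ _ => by rw [Real.volume_Ioc]; exact ENNReal.ofReal_ne_top)]
    · have : ∀ k : ℕ, volume.real (Ioc ((k:ℝ) * h) ((k + 1) * h)) = h := by
        intro k
        rw [Real.volume_real_Ioc_of_le (by nlinarith)]; ring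
      simp [this]
    · have key2 : ∀ s t : ℕ, s < t → Disjoint (Ioc ((s:ℝ) * h) ((s + 1) * h)) (Ioc ((t:ℝ) * h) ((t + 1) * h)) := by
        intro s t hst
        rw [disjoint_left]
        rintro x ⟨_, hx⟩ ⟨hx', _⟩
        have : (s:ℝ) + 1 ≤ t := by exact_mod_cast hst
        nlinarith
      intro s _ t _ hst
      rcases lt_or_gt_of_ne hst with h' | h'
      · exact key2 s t h'
      · exact (key2 t s h').symm
    · intro _ _; exact measurableSet_Ioc
  have hfin := measureReal_mono (μ := volume) hcell ((measure_mono inter_subset_right).trans_lt (by simp)).ne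
  rw [hvol] at hfin
  refine le_trans ?_ hfin
  rw [← mul_assoc]
  gcongr
  exact hmann

lemma cont_mann {Y : Set ℝ} (hY0 : 0 ∈ Y) (hYc : IsCompact Y) (hYp : Y ⊆ Ici 0) {X κ κ' : ℝ} (hX : 0 < X)
    (hκ0 : 0 ≤ κ) (hκκ : κ' < κ)
    (hκ' : κ' ≤ 1/2) (hd : ∀ x, 0 ≤ x → x ≤ X → κ * x ≤ volume.real (Y ∩ Icc 0 x)) :
    2 * κ' * X ≤ volume.real ((Y + Y) ∩ Icc 0 X) := by
  obtain ⟨n0, hn0⟩ := exists_nat_ge (1 / (κ - κ'))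
  rw [div_le_iff₀ (by linarith)] at hn0
  have step := mann_step hY0 hYc hYp hX hκ0 hκ' hd n0 (by linarith)
  have lim0 : Filter.Tendsto (fun N : ℕ => X / ((N:ℝ) + 1)) Filter.atTop (nhds 0) := by
    have := (tendsto_one_div_add_atTop_nhds_zero_nat (𝕜 := ℝ)).const_mul X
    simpa [div_eq_mul_inv] using this
  have limL : Filter.Tendsto (fun N : ℕ => 2 * κ' * (N * (X / ((N:ℝ) + 1)))) Filter.atTop (nhds (2 * κ' * X)) := by
    have : (fun N : ℕ => 2 * κ' * (N * (X / ((N:ℝ) + 1)))) = fun N : ℕ => 2 * κ' * (X - X / ((N:ℝ) + 1)) := by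
      funext N
      have : (N:ℝ) + 1 ≠ 0 := by positivity
      field_simp
      ring
    rw [this]
    simpa using (lim0.const_sub X).const_mul (2 * κ')
  have limR : Filter.Tendsto (fun N : ℕ => volume.real (Metric.cthickening ((2 * n0 + 3) * (X / ((N:ℝ) + 1))) (Y + Y) ∩ Icc 0 X))
      Filter.atTop (nhds (volume.real ((Y + Y) ∩ Icc 0 X))) := by
    have hcl : IsClosed (Y + Y) := (hYc.add hYc).isClosed
    have h1 : Filter.Tendsto (fun r => (volume.restrict (Icc 0 X)) (Metric.cthickening r (Y + Y)))
        (nhds 0) (nhds ((volume.restrict (Icc 0 X)) (Y + Y))) := by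
      apply tendsto_measure_cthickening_of_isClosed _ hcl
      exact ⟨1, one_pos, ((Measure.restrict_apply_le _ _).trans_lt (by
        exact (hYc.add hYc).cthickening.measure_lt_top)).ne⟩
    have h2 : Filter.Tendsto (fun N : ℕ => (2 * n0 + 3) * (X / ((N:ℝ) + 1))) Filter.atTop (nhds 0) := by
      simpa using lim0.const_mul (2 * (n0:ℝ) + 3)
    have h3 := h1.comp h2
    have h4 := (ENNReal.tendsto_toReal (by
      rw [Measure.restrict_apply hcl.measurableSet]
      exact ((measure_mono inter_subset_right).trans_lt (by simp)).ne)).comp h3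
    simp only [Measure.restrict_apply hcl.measurableSet] at h4
    refine h4.congr ?_
    intro N
    simp only [Function.comp, Measure.real]
    rw [Measure.restrict_apply Metric.isClosed_cthickening.measurableSet]
  exact le_of_tendsto_of_tendsto' limL limR step

lemma mann_cor {A : Set ℝ} (hA : A ⊆ Icc (0 : ℝ) 1) (hc : IsCompact A) (hs : SF A) (h1 : (1:ℝ) ∈ A)
    {X κ κ' : ℝ} (hX : 0 < X)
    (hκ0 : 0 ≤ κ) (hκκ : κ' < κ) (hκ' : κ' ≤ 1/2)
    (hd : ∀ x, 0 ≤ x → x ≤ X → κ * x ≤ Gd A 1 - Gd A (1 - x)) :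
    3 * (Gd A (2/3) - Gd A ((2 - X)/3)) ≤ X - 2 * κ' * X := by
  have hm := hc.measurableSet
  set Y := (fun x : ℝ => (-1) * x + 1) '' A with hY
  have hYc : IsCompact Y := hc.image (by fun_prop)
  have hcm := cont_mann (Y := Y) ⟨1, h1, by norm_num⟩ hYc (by
    rintro _ ⟨x, hx, rfl⟩
    have := (hA hx).2
    simp only [mem_Ici]; linarith) hX hκ0 hκκ hκ' (by
    intro x hx0 hx1
    refine (hd x hx0 hx1).trans ?_
    rw [← Gd_sub hA hm (by linarith)]
    have := vol_affine (-1) 1 (A ∩ Ioc (1 - x) 1)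
    simp only [abs_neg, abs_one, one_mul] at this
    rw [← this]
    apply measureReal_mono
    · rintro _ ⟨z, ⟨hz, hz1, hz2⟩, rfl⟩
      refine ⟨⟨z, hz, rfl⟩, ?_, ?_⟩ <;> simp only <;> linarith
    · exact ((measure_mono inter_subset_right).trans_lt (by simp)).ne)
  set T := (fun x : ℝ => (-3) * x + 2) '' (A ∩ Ioc ((2 - X)/3) (2/3)) with hT
  have hTv : volume.real T = 3 * (Gd A (2/3) - Gd A ((2 - X)/3)) := by
    rw [hT, vol_affine, Gd_sub hA hm (by linarith)]; norm_num
  have hTm : T ⊆ Icc 0 X := by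
    rintro _ ⟨z, ⟨hz, hz1, hz2⟩, rfl⟩
    constructor <;> simp only <;> linarith
  have hdis : Disjoint T ((Y + Y) ∩ Icc 0 X) := by
    rw [disjoint_left]
    rintro _ ⟨z, ⟨hz, _⟩, rfl⟩ ⟨hy, _⟩
    obtain ⟨_, ⟨x, hx, rfl⟩, _, ⟨y, hy, rfl⟩, hxy⟩ := hy
    simp only at hxy
    exact hs x hx y hy z hz (by linarith)
  have hu := measureReal_union (μ := volume) hdis
    ((hYc.add hYc).isClosed.measurableSet.inter measurableSet_Icc)
    ((measure_mono hTm).trans_lt (by simp)).ne ((measure_mono inter_subset_right).trans_lt (by simp)).ne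
  have hle : volume.real (T ∪ (Y + Y) ∩ Icc 0 X) ≤ volume.real (Icc 0 X) :=
    measureReal_mono (union_subset hTm inter_subset_right) (by simp)
  rw [Real.volume_real_Icc_of_le hX.le] at hle
  linarith

lemma Gd_cont {A : Set ℝ} (hA : A ⊆ Icc (0 : ℝ) 1) (hm : MeasurableSet A) : Continuous (Gd A) := by
  have : LipschitzWith 1 (Gd A) := by
    apply LipschitzWith.of_le_add_mul
    intro x y
    rcases le_total x y with h | h
    · have := Gd_mono hA hm h
      have : 0 ≤ dist x y := dist_nonneg
      simp; linarith
    · have := Gd_lip hA hm h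
      rw [Real.dist_eq, abs_of_nonneg (by linarith)]
      simp; linarith
  exact this.continuous

lemma scale {A : Set ℝ} (hA : A ⊆ Icc (0 : ℝ) 1) (hc : IsCompact A) (hs : SF A)
    {a : ℝ} (ha : IsLeast A a) {t : ℝ} (ht : 0 < t) (hat : a ≤ t) :
    ∃ A' : Set ℝ, A' ⊆ Icc (0 : ℝ) 1 ∧ IsCompact A' ∧ SF A' ∧ IsLeast A' (a / t) ∧
      (∀ x ≤ 1, Gd A' x = Gd A (t * x) / t) ∧ (t ∈ A → 1 ∈ A') := by
  have hmem : ∀ x, x ∈ (fun x : ℝ => t⁻¹ * x + 0) '' (A ∩ Iic t) ↔ t * x ∈ A ∧ x ≤ 1 := by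
    intro x
    constructor
    · rintro ⟨y, ⟨hy, hy1⟩, rfl⟩
      have e : t * (t⁻¹ * y + 0) = y := by field_simp; ring
      refine ⟨by rw [e]; exact hy, ?_⟩
      simp only [mem_Iic] at hy1
      change t⁻¹ * y + 0 ≤ 1
      rw [add_zero, inv_mul_le_iff₀ ht]; linarith
    · rintro ⟨h1, h2⟩
      refine ⟨t * x, ⟨h1, ?_⟩, by field_simp; ring⟩
      simp only [mem_Iic]; nlinarith
  refine ⟨(fun x : ℝ => t⁻¹ * x + 0) '' (A ∩ Iic t), ?_, ?_, ?_, ?_, ?_, ?_⟩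
  · intro x hx
    rw [hmem] at hx
    have := (hA hx.1).1
    exact ⟨by by_contra hcon; push Not at hcon; nlinarith, hx.2⟩
  · exact (hc.inter_right isClosed_Iic).image (by fun_prop)
  · intro x hx y hy z hz h
    rw [hmem] at hx hy hz
    exact hs _ hx.1 _ hy.1 _ hz.1 (by linear_combination t * h)
  · constructor
    · rw [hmem]
      refine ⟨?_, ?_⟩
      · rw [mul_div_cancel₀ _ ht.ne']; exact ha.1
      · rw [div_le_one ht]; exact hat
    · intro x hx
      rw [hmem] at hx
      rw [div_le_iff₀ ht, mul_comm]
      exact ha.2 hx.1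
  · intro x hx
    have : (fun x : ℝ => t⁻¹ * x + 0) '' (A ∩ Iic t) ∩ Iic x
        = (fun x : ℝ => t⁻¹ * x + 0) '' (A ∩ Iic (t * x)) := by
      ext z
      rw [mem_inter_iff, hmem]
      constructor
      · rintro ⟨⟨h1, h2⟩, h3⟩
        refine ⟨t * z, ⟨h1, ?_⟩, by field_simp; ring⟩
        simp only [mem_Iic] at h3 ⊢; nlinarith
      · rintro ⟨y, ⟨hy, hy1⟩, rfl⟩
        have e : t * (t⁻¹ * y + 0) = y := by field_simp; ring
        simp only [mem_Iic] at hy1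
        have e2 : t⁻¹ * y + 0 ≤ x := by
          rw [add_zero, inv_mul_le_iff₀ ht]; linarith
        exact ⟨⟨by rw [e]; exact hy, e2.trans hx⟩, e2⟩
    unfold Gd
    rw [this, vol_affine, abs_of_pos (by positivity)]
    field_simp
  · intro h
    rw [hmem]; simpa using h

lemma reduce {A : Set ℝ} (hA : A ⊆ Icc (0 : ℝ) 1) (hc : IsCompact A) (hs : SF A)
    {a : ℝ} (ha : IsLeast A a) {lam K : ℝ} (hK : 0 < K)
    (hbig : K < Gd A 1 + lam * a) :
    ∃ (A' : Set ℝ) (a' : ℝ), A' ⊆ Icc (0 : ℝ) 1 ∧ IsCompact A' ∧ SF A' ∧ IsLeast A' a' ∧ 1 ∈ A' ∧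
      K < Gd A' 1 + lam * a' ∧ ∀ t, a' ≤ t → t ≤ 1 → K * (1 - t) ≤ Gd A' 1 - Gd A' t := by
  have hm := hc.measurableSet
  have ha01 := hA ha.1
  have ha0 : 0 < a := by
    rcases ha01.1.lt_or_eq with h | h
    · exact h
    · exact absurd (by rw [← h]; ring) (hs a ha.1 a ha.1 a ha.1)
  obtain ⟨t1, ht1, hmax⟩ := (isCompact_Icc (a := a) (b := 1)).exists_isMaxOn ⟨a, le_rfl, ha01.2⟩
    (f := fun t => Gd A t - K * t) (by have := Gd_cont hA hm; fun_prop)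
  have hmax' : ∀ t, a ≤ t → t ≤ 1 → Gd A t - K * t ≤ Gd A t1 - K * t1 := fun t h1 h2 => hmax ⟨h1, h2⟩
  have ht0 : 0 < t1 := by linarith [ht1.1]
  have ht1A : t1 ∈ A := by
    obtain ⟨f, ⟨hfA, hf0, hfq⟩, hfmax⟩ :=
      (hc.inter_right (isClosed_Icc (a := a) (b := t1))).exists_isGreatest
        ⟨a, ha.1, le_refl _, ht1.1⟩
    have hGf : Gd A t1 = Gd A f := Gd_gap hA hm hfq
      (fun x hx h2 h3 => absurd (hfmax ⟨hx, ha.2 hx, h3.le⟩) (not_le.mpr h2))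
    have := hmax' f hf0 (hfq.trans ht1.2)
    have h3 : t1 ≤ f := by
      by_contra hcon; push Not at hcon; nlinarith
    rwa [le_antisymm h3 hfq]
  obtain ⟨A', h1, h2, h3, h4, h5, h6⟩ := scale hA hc hs ha ht0 ht1.1
  refine ⟨A', a / t1, h1, h2, h3, h4, h6 ht1A, ?_, ?_⟩
  · rw [h5 1 le_rfl, mul_one]
    have := hmax' 1 ha01.2 le_rfl
    have e : Gd A t1 / t1 + lam * (a / t1) = (Gd A t1 + lam * a) / t1 := by ring
    rw [e, lt_div_iff₀ ht0]
    linarith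
  · intro t hat ht
    rw [h5 1 le_rfl, mul_one, h5 t ht, ← sub_div, le_div_iff₀ ht0]
    rw [div_le_iff₀ ht0] at hat
    have := hmax' (t1 * t) (by linarith) (by nlinarith [ht1.2])
    nlinarith

lemma P1 {A : Set ℝ} (hA : A ⊆ Icc (0 : ℝ) 1) (hc : IsCompact A) (hs : SF A)
    {a : ℝ} (ha : IsLeast A a) : Gd A 1 + 9/59 * a ≤ 27/59 := by
  by_contra hcon
  push Not at hcon
  obtain ⟨A, a, hA, hc, hs, ha, h1, hbig, hsuf⟩ := reduce hA hc hs ha (by norm_num) hcon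
  have hm := hc.measurableSet
  have mono := fun {p q : ℝ} (h : p ≤ q) => Gd_mono hA hm h
  have lip := fun {p q : ℝ} (h : p ≤ q) => Gd_lip hA hm h
  have ha0 : 0 ≤ a := (hA ha.1).1
  have ha1 : a ≤ 1 := (hA ha.1).2
  have hGa : ∀ x ≤ a, Gd A x = 0 := fun x hx => Gd_least ha hx
  have hGa' := hGa a le_rfl
  have haS : a < 0.64 := by
    have := lip ha1
    linarith
  have hsuf' : ∀ t, a / 3 ≤ t → t ≤ 1 → 27/59 * (1 - t) ≤ Gd A 1 - Gd A t := by
    intro t h2 h3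
    rcases le_total a t with h | h
    · exact hsuf t h h3
    · rw [hGa t h]; linarith
  have hmann := mann_cor hA hc hs h1 (X := 1 - a/3) (κ := 27/59) (κ' := 0.4575) (by linarith)
    (by norm_num) (by norm_num) (by norm_num) (by
      intro x hx0 hx1
      have := hsuf' (1 - x) (by linarith) (by linarith)
      linarith)
  have hmid := hsuf' ((2 - (1 - a/3))/3) (by linarith) (by linarith)
  have hM3 : 1/4 ≤ Gd A 1 - Gd A (2/3) := by linarith
  have hk := key hA hc hs h1 ha hM3
  rcases le_total (2/9 + a/3) a with h | h
  · rw [hGa _ h] at hk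
    linarith
  obtain ⟨s1, s2, s3⟩ := smallB hA hc hs ha h
  have hlow := hsuf' (2/9 + a/3) (by linarith) (by linarith)
  by_cases c1 : 4/21 ≤ a
  · linarith
  push Not at c1
  by_cases c2 : 5/33 ≤ a
  · have := s2 (by linarith)
    linarith
  push Not at c2
  have := s3 (by linarith)
  by_cases c3 : 0.14 ≤ a
  · linarith
  · linarith

lemma P1s {A : Set ℝ} (hA : A ⊆ Icc (0 : ℝ) 1) (hc : IsCompact A) (hs : SF A)
    {a : ℝ} (ha : IsLeast A a) {t : ℝ} (ht : 0 < t) (hat : a ≤ t) :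
    Gd A t ≤ 27/59 * t - 9/59 * a := by
  obtain ⟨A', h1, h2, h3, h4, h5, h6⟩ := scale hA hc hs ha ht hat
  have := P1 h1 h2 h3 h4
  rw [h5 1 le_rfl, mul_one] at this
  have e : Gd A t / t + 9/59 * (a / t) = (Gd A t + 9/59 * a) / t := by ring
  rw [e, div_le_iff₀ ht] at this
  linarith

lemma P2 {A : Set ℝ} (hA : A ⊆ Icc (0 : ℝ) 1) (hc : IsCompact A) (hs : SF A)
    {a : ℝ} (ha : IsLeast A a) : Gd A 1 ≤ 77/177 := by
  by_contra hcon
  push Not at hcon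
  obtain ⟨A, a, hA, hc, hs, ha, h1, hbig, hsuf⟩ := reduce (lam := 0) hA hc hs ha
    (by norm_num : (0:ℝ) < 77/177) (by linarith)
  have hm := hc.measurableSet
  have mono := fun {p q : ℝ} (h : p ≤ q) => Gd_mono hA hm h
  have lip := fun {p q : ℝ} (h : p ≤ q) => Gd_lip hA hm h
  have ha0 : 0 ≤ a := (hA ha.1).1
  have hp := P1 hA hc hs ha
  have haS : a < 4/27 := by linarith
  have hs1 := P1s hA hc hs ha (t := 2/9 + a/3) (by linarith) (by linarith)
  have hsuf' : ∀ t, 0 ≤ t → t ≤ 1 → 77/177 * (1 - t) ≤ Gd A 1 - Gd A t := by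
    intro t h2 h3
    rcases le_total a t with h | h
    · exact hsuf t h h3
    · rw [Gd_least ha h]; linarith
  have hmann := mann_cor hA hc hs h1 (X := 1) (κ := 77/177) (κ' := 0.434) (by norm_num)
    (by norm_num) (by norm_num) (by norm_num) (by
      intro x hx0 hx1
      have := hsuf' (1 - x) (by linarith) (by linarith)
      linarith)
  rw [show ((2:ℝ) - 1)/3 = 1/3 by norm_num] at hmann
  have hpa := piece hA hm hs ha.1 (p := 2/9 + a/3) (q := (1+a)/3) (by linarith)
  rw [show 3 * ((1 + a)/3) - a = 1 by ring, show 3 * (2/9 + a/3) - a = 2/3 by ring] at hpa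
  have e1 := mono (p := 1/3) (q := (1+a)/3) (by linarith)
  have hM3 : 1/4 ≤ Gd A 1 - Gd A (2/3) := by linarith
  have hk := key hA hc hs h1 ha hM3
  linarith

/-- **Theorem 1 (main theorem).** If `A` is a measurable 3-sum-free subset of `[0,1]`,
then its Lebesgue measure is at most `77/177`. -/
theorem measure_le_of_three_sum_free (A : Set ℝ)
    (hA : A ⊆ Icc (0 : ℝ) 1) (hmeas : MeasurableSet A)
    (hsf : ∀ x ∈ A, ∀ y ∈ A, ∀ z ∈ A, x + y ≠ 3 * z) :
    volume A ≤ 77 / 177 := by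
  by_contra hcon
  push Not at hcon
  obtain ⟨C, hCA, hc, hlt⟩ := hmeas.exists_lt_isCompact hcon
  have hne : C.Nonempty := by
    by_contra h
    rw [not_nonempty_iff_eq_empty] at h
    rw [h] at hlt
    simp at hlt
  obtain ⟨a, ha⟩ := hc.exists_isLeast hne
  have hC1 := hCA.trans hA
  have h := P2 hC1 hc (fun x hx y hy z hz => hsf x (hCA hx) y (hCA hy) z (hCA hz)) ha
  rw [Gd_one hC1] at h
  have h2 := ENNReal.toReal_strict_mono (fin_sub hC1 (Subset.refl C)) hlt
  have h3 : (77 / 177 : ENNReal).toReal = 77/177 := by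
    rw [ENNReal.toReal_div]; norm_num
  rw [h3] at h2
  exact absurd h (not_le.mpr h2)
end

section
/- The set 𝒜₀ = (8/177, 4/59) ∪ (28/177, 14/59) ∪ (2/3, 1) is 3-sum-free and its Lebesgue measure equals 77/177. -/
open MeasureTheory Set

/-- The set `𝒜₀ = (8/177, 4/59) ∪ (28/177, 14/59) ∪ (2/3, 1)` is 3-sum-free and has
Lebesgue measure `77/177`. -/
theorem A0_three_sum_free_and_measure :
    (∀ x ∈ (Ioo (8/177 : ℝ) (4/59) ∪ Ioo (28/177 : ℝ) (14/59) ∪ Ioo (2/3 : ℝ) 1),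
      ∀ y ∈ (Ioo (8/177 : ℝ) (4/59) ∪ Ioo (28/177 : ℝ) (14/59) ∪ Ioo (2/3 : ℝ) 1),
        ∀ z ∈ (Ioo (8/177 : ℝ) (4/59) ∪ Ioo (28/177 : ℝ) (14/59) ∪ Ioo (2/3 : ℝ) 1),
          x + y ≠ 3 * z) ∧
    volume (Ioo (8/177 : ℝ) (4/59) ∪ Ioo (28/177 : ℝ) (14/59) ∪ Ioo (2/3 : ℝ) 1)
      = 77 / 177 := by
  constructor
  · rintro x ((⟨hx1, hx2⟩ | ⟨hx1, hx2⟩) | ⟨hx1, hx2⟩) y ((⟨hy1, hy2⟩ | ⟨hy1, hy2⟩) | ⟨hy1, hy2⟩)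
      z ((⟨hz1, hz2⟩ | ⟨hz1, hz2⟩) | ⟨hz1, hz2⟩) h <;> linarith
  · rw [measure_union _ measurableSet_Ioo, measure_union _ measurableSet_Ioo,
      Real.volume_Ioo, Real.volume_Ioo, Real.volume_Ioo,
      ← ENNReal.ofReal_add (by norm_num) (by norm_num),
      ← ENNReal.ofReal_add (by norm_num) (by norm_num)]
    · have h : (77 / 177 : ENNReal) = ENNReal.ofReal (77 / 177) := by
        rw [ENNReal.ofReal_div_of_pos (by norm_num)]
        norm_num
      rw [h]
      norm_num
    · rw [Set.disjoint_left]
      rintro x ⟨h1, h2⟩ ⟨h3, h4⟩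
      linarith
    · rw [Set.disjoint_left]
      rintro x (⟨h1, h2⟩ | ⟨h1, h2⟩) ⟨h3, h4⟩ <;> linarith
end

section
/- For every choice x ∈ {8/177, 4/59}, y ∈ {28/177, 14/59}, z ∈ {2/3, 1} with (x,y,z) ≠ (8/177, 14/59, 2/3), the set 𝒜₀ ∪ {x, y, z} is 3-sum-free. -/
open MeasureTheory Set

set_option maxHeartbeats 4000000 in
/-- For every choice of endpoints `x ∈ {8/177, 4/59}`, `y ∈ {28/177, 14/59}`,
`z ∈ {2/3, 1}` with `(x,y,z) ≠ (8/177, 14/59, 2/3)`, the set `𝒜₀ ∪ {x, y, z}` is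
3-sum-free. -/
theorem A0_with_endpoints_three_sum_free
    (x : ℝ) (hx : x ∈ ({8/177, 4/59} : Set ℝ))
    (y : ℝ) (hy : y ∈ ({28/177, 14/59} : Set ℝ))
    (z : ℝ) (hz : z ∈ ({2/3, 1} : Set ℝ))
    (hne : (x, y, z) ≠ ((8/177 : ℝ), (14/59 : ℝ), (2/3 : ℝ))) :
    ∀ u ∈ (Ioo (8/177 : ℝ) (4/59) ∪ Ioo (28/177 : ℝ) (14/59) ∪ Ioo (2/3 : ℝ) 1)
        ∪ {x, y, z},
      ∀ v ∈ (Ioo (8/177 : ℝ) (4/59) ∪ Ioo (28/177 : ℝ) (14/59) ∪ Ioo (2/3 : ℝ) 1)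
          ∪ {x, y, z},
        ∀ w ∈ (Ioo (8/177 : ℝ) (4/59) ∪ Ioo (28/177 : ℝ) (14/59) ∪ Ioo (2/3 : ℝ) 1)
            ∪ {x, y, z},
          u + v ≠ 3 * w := by
  simp only [mem_insert_iff, mem_singleton_iff] at hx hy hz
  have key : ∀ u ∈ (Ioo (8/177 : ℝ) (4/59) ∪ Ioo (28/177 : ℝ) (14/59) ∪ Ioo (2/3 : ℝ) 1)
        ∪ {x, y, z}, (u ∈ Ioo (8/177 : ℝ) (4/59) ∨ u = x) ∨
          (u ∈ Ioo (28/177 : ℝ) (14/59) ∨ u = y) ∨ (u ∈ Ioo (2/3 : ℝ) 1 ∨ u = z) := by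
    intro u hu
    simp only [mem_union, mem_insert_iff, mem_singleton_iff] at hu
    tauto
  have half : ∀ a b t : ℝ, a < b → (t = a ∨ t = b) →
      (t = a ∧ ∀ u, (u ∈ Ioo a b ∨ u = t) → a ≤ u ∧ u < b) ∨
      (t = b ∧ ∀ u, (u ∈ Ioo a b ∨ u = t) → a < u ∧ u ≤ b) := by
    rintro a b t hab (rfl | rfl)
    · refine Or.inl ⟨rfl, ?_⟩
      rintro u (hu | rfl)
      · exact ⟨hu.1.le, hu.2⟩
      · exact ⟨le_rfl, hab⟩
    · refine Or.inr ⟨rfl, ?_⟩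
      rintro u (hu | rfl)
      · exact ⟨hu.1, hu.2.le⟩
      · exact ⟨hab, le_rfl⟩
  intro u hu v hv w hw h
  replace hu := key u hu
  replace hv := key v hv
  replace hw := key w hw
  clear key
  have hX := half _ _ x (by norm_num) hx
  have hY := half _ _ y (by norm_num) hy
  have hZ := half _ _ z (by norm_num) hz
  clear half hx hy hz
  rcases hX with ⟨ex, hX⟩ | ⟨ex, hX⟩ <;> rcases hY with ⟨ey, hY⟩ | ⟨ey, hY⟩ <;>
  rcases hZ with ⟨ez, hZ⟩ | ⟨ez, hZ⟩ <;>
  first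
  | exact hne (Prod.ext ex (Prod.ext ey ez))
  | (clear hne ex ey ez
     replace hu := hu.imp (hX u) (Or.imp (hY u) (hZ u))
     replace hv := hv.imp (hX v) (Or.imp (hY v) (hZ v))
     replace hw := hw.imp (hX w) (Or.imp (hY w) (hZ w))
     clear hX hY hZ
     rcases hu with hu | hu | hu <;> rcases hv with hv | hv | hv <;>
     rcases hw with hw | hw | hw <;> linarith)
end

section
/- Let A and B be two bounded measurable subsets of ℝ with 0 < μ(A) ≤ μ(B). Then the inner Lebesgue measure of the Minkowski sumset A+B satisfies μ_*(A+B) ≥ min(2μ(A) + μ(B), μ(A) + diam(B)), where diam(B) = sup B − inf B. -/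
open MeasureTheory Set
open scoped Pointwise

/-- The inner Lebesgue measure of a set of reals: the supremum of the measures of
compact subsets. -/
noncomputable def innerMeasure (S : Set ℝ) : ENNReal :=
  ⨆ (K : Set ℝ) (_ : IsCompact K) (_ : K ⊆ S), volume K


lemma ruzsa_finite (p : ℕ) (hp : p.Prime) (A B : Finset ℤ) (hA : A.Nonempty)
    (hB : ∀ b ∈ B, 0 ≤ b ∧ b ≤ p) (h0 : (0:ℤ) ∈ B) (h1 : (p:ℤ) ∈ B) :
    A.card + p ≤ (A + B).card ∨ 2 * A.card + B.card ≤ (A + B).card + 2 ∨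
      A.card + 2 * B.card ≤ (A + B).card + 4 := by
  classical
  have : Fact p.Prime := ⟨hp⟩
  set φ : ℤ → ZMod p := fun z => (z : ZMod p) with hφ
  set N : Finset ℤ → ZMod p → ℕ := fun S r => (S.filter (fun z => φ z = r)).card with hN
  have hsum : ∀ S : Finset ℤ, S.card = ∑ r, N S r := fun S =>
    Finset.card_eq_sum_card_fiberwise (fun x _ => Finset.mem_coe.2 (Finset.mem_univ (φ x)))
  set A1 := A.image φ with hA1
  set B' := B.image φ with hB'
  set A2 : Finset (ZMod p) := Finset.univ.filter (fun r => 2 ≤ N A r) with hA2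
  have hA2N : ∀ r, r ∈ A2 ↔ 2 ≤ N A r := fun r => by simp [hA2]
  have hA1N : ∀ r, r ∈ A1 ↔ 1 ≤ N A r := fun r => by
    simp only [hA1, hN, Finset.one_le_card, Finset.mem_image, Finset.Nonempty, Finset.mem_filter]
  have hA21 : A2 ⊆ A1 := fun r hr => by
    rw [hA1N]; rw [hA2N] at hr; omega
  have hA1ne : A1.Nonempty := hA.image _
  have h0' : (0 : ZMod p) ∈ B' := Finset.mem_image.2 ⟨0, h0, by simp [hφ]⟩
  have hB'ne : B'.Nonempty := ⟨_, h0'⟩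
  have hBc : B.card ≤ B'.card + 1 := by
    have : (B.erase (p:ℤ)).card ≤ B'.card := by
      apply Finset.card_le_card_of_injOn φ
      · intro x hx
        exact Finset.mem_coe.2 (Finset.mem_image_of_mem _ (Finset.mem_of_mem_erase hx))
      · intro x hx y hy hxy
        have hx' := Finset.mem_erase.1 hx
        have hy' := Finset.mem_erase.1 hy
        have a1 := hB x hx'.2
        have a2 := hB y hy'.2
        have := (ZMod.intCast_eq_intCast_iff x y p).1 hxy
        have h3 : x % p = y % p := this
        rw [Int.emod_eq_of_lt a1.1 (lt_of_le_of_ne a1.2 hx'.1),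
          Int.emod_eq_of_lt a2.1 (lt_of_le_of_ne a2.2 hy'.1)] at h3
        exact h3
    rw [Finset.card_erase_of_mem h1] at this
    omega
  -- fibre bounds
  have i1 : ∀ r ∈ A1, N A r + 1 ≤ N (A + B) r := by
    intro r hr
    have hne : (A.filter (fun z => φ z = r)).Nonempty := by
      rw [← Finset.one_le_card]; exact (hA1N r).1 hr
    set F := A.filter (fun z => φ z = r) with hF
    have hm := F.max'_mem hne
    set m := F.max' hne with hmdef
    have hnot : m + p ∉ F := by
      intro h
      have := F.le_max' _ h
      have hp0 := hp.pos
      omega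
    have : (insert (m + (p:ℤ)) F).card ≤ N (A + B) r := by
      apply Finset.card_le_card
      intro z hz
      rw [Finset.mem_insert] at hz
      rcases hz with rfl | hz
      · rw [hF, Finset.mem_filter] at hm
        refine Finset.mem_filter.2 ⟨Finset.add_mem_add hm.1 h1, ?_⟩
        simpa [hφ] using hm.2
      · rw [hF, Finset.mem_filter] at hz
        refine Finset.mem_filter.2 ⟨?_, hz.2⟩
        simpa using Finset.add_mem_add hz.1 h0
    rwa [Finset.card_insert_of_notMem hnot] at this
  have i2' : ∀ r ∈ A1, ∀ s ∈ B', N A r ≤ N (A + B) (r + s) := by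
    intro r hr s hs
    obtain ⟨b, hb, rfl⟩ := Finset.mem_image.1 hs
    apply Finset.card_le_card_of_injOn (fun z => z + b)
    · intro z hz
      have hz := Finset.mem_filter.1 (Finset.mem_coe.1 hz)
      refine Finset.mem_coe.2 (Finset.mem_filter.2 ⟨Finset.add_mem_add hz.1 hb, ?_⟩)
      rw [← hz.2]; simp [hφ]
    · intro x _ y _ hxy
      simpa using hxy
  have i2 : ∀ r ∈ A1 + B', 1 ≤ N (A + B) r := by
    intro r hr
    obtain ⟨x, hx, y, hy, rfl⟩ := Finset.mem_add.1 hr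
    exact ((hA1N x).1 hx).trans (i2' x hx y hy)
  have i3 : ∀ r ∈ A2 + B', 2 ≤ N (A + B) r := by
    intro r hr
    obtain ⟨x, hx, y, hy, rfl⟩ := Finset.mem_add.1 hr
    exact ((hA2N x).1 hx).trans (i2' x (hA21 hx) y hy)
  have hsub1 : A1 ⊆ A1 + B' := fun r hr => by simpa using Finset.add_mem_add hr h0'
  have hind : ∀ T : Finset (ZMod p), T.card = ∑ r, if r ∈ T then 1 else 0 := fun T => by simp
  have N0 : ∀ r, r ∉ A1 → N A r = 0 := fun r hr => by rw [hA1N] at hr; omega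
  have b1 : A.card + (A1 + B').card ≤ (A + B).card := by
    rw [hsum A, hsum (A + B), hind, ← Finset.sum_add_distrib]
    apply Finset.sum_le_sum
    intro r _
    by_cases hr : r ∈ A1
    · rw [if_pos (hsub1 hr)]; exact i1 r hr
    · rw [N0 r hr]
      split_ifs with h
      · simpa using i2 r h
      · simp
  have c1 := ZMod.cauchy_davenport hp hA1ne hB'ne
  have bp := hA1ne.card_pos
  have bp2 := hB'ne.card_pos
  by_cases hfull : p ≤ (A1 + B').card
  · left; omega
  right
  rcases A2.eq_empty_or_nonempty with he | hne
  · left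
    have : A.card = A1.card := by
      rw [hsum A, hind]
      refine Finset.sum_congr rfl fun r _ => ?_
      have h2 : ¬ 2 ≤ N A r := by rw [← hA2N, he]; simp
      split_ifs with h
      · have := (hA1N r).1 h; omega
      · exact N0 r h
    rcases min_le_iff.1 c1 with h | h <;> omega
  · right
    have c2 := ZMod.cauchy_davenport hp hne hB'ne
    have hle : (A2 + B').card ≤ (A1 + B').card :=
      Finset.card_le_card (Finset.add_subset_add_right hA21)
    have b2 : A.card + (A1 + B').card + (A2 + B').card ≤ (A + B).card + A1.card + A2.card := by
      rw [hsum A, hsum (A + B), hind (A1 + B'), hind (A2 + B'), hind A1, hind A2,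
        ← Finset.sum_add_distrib, ← Finset.sum_add_distrib, ← Finset.sum_add_distrib,
        ← Finset.sum_add_distrib]
      apply Finset.sum_le_sum
      intro r _
      have j1 := i1 r
      have j2 := i2 r
      have j3 := i3 r
      have j4 := @hsub1 r
      have j5 := N0 r
      have j6 := hA1N r
      have j7 := hA2N r
      have j8 := @hA21 r
      split_ifs <;> grind
    have bp3 := hne.card_pos
    rcases min_le_iff.1 c1 with h | h <;> rcases min_le_iff.1 c2 with h' | h' <;> omega

lemma ruzsa_floor_finite (A : Set ℝ) (hA : Bornology.IsBounded A) (β h : ℝ) (hh : 0 < h) :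
    ((fun x : ℝ => ⌊(x - β) / h⌋) '' A).Finite := by
  obtain ⟨l, hl⟩ := hA.bddBelow
  obtain ⟨u, hu⟩ := hA.bddAbove
  apply (Set.finite_Icc ⌊(l - β) / h⌋ ⌊(u - β) / h⌋).subset
  rintro _ ⟨x, hx, rfl⟩
  have h1 := hl hx
  have h2 := hu hx
  constructor <;> apply Int.floor_le_floor <;> gcongr

lemma ruzsa_cover (A : Set ℝ) (β h : ℝ) (hh : 0 < h) (T : Finset ℤ)
    (hT : ∀ x ∈ A, ⌊(x - β) / h⌋ ∈ T) : volume A ≤ T.card * ENNReal.ofReal h := by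
  have hsub : A ⊆ ⋃ k ∈ T, Ico (β + k * h) (β + (k + 1) * h) := by
    intro x hx
    refine mem_iUnion₂.2 ⟨_, hT x hx, ?_⟩
    have h1 := Int.floor_le ((x - β) / h)
    have h2 := Int.lt_floor_add_one ((x - β) / h)
    rw [le_div_iff₀ hh] at h1
    rw [div_lt_iff₀ hh] at h2
    constructor <;> linarith
  refine (measure_mono hsub).trans ((measure_biUnion_finset_le _ _).trans ?_)
  have : ∀ k : ℤ, volume (Ico (β + k * h) (β + (k + 1) * h)) = ENNReal.ofReal h := by
    intro k; rw [Real.volume_Ico]; congr 1; ring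
  simp [this]

lemma ruzsa_pack (β h : ℝ) (hh : 0 < h) (T : Finset ℤ) (V : Set ℝ)
    (hT : ∀ k ∈ T, Ico (β + k * h) (β + (k + 1) * h) ⊆ V) :
    T.card * ENNReal.ofReal h ≤ volume V := by
  have : ∀ k : ℤ, volume (Ico (β + k * h) (β + (k + 1) * h)) = ENNReal.ofReal h := by
    intro k; rw [Real.volume_Ico]; congr 1; ring
  have key : volume (⋃ k ∈ T, Ico (β + (k:ℝ) * h) (β + ((k:ℝ) + 1) * h))
      = T.card * ENNReal.ofReal h := by
    rw [measure_biUnion_finset]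
    · simp [this]
    · intro i _ j _ hij
      refine Set.disjoint_left.2 fun x hx hy => hij ?_
      have e1 : (i:ℝ) < j + 1 := by
        have := hx.1.trans_lt hy.2
        by_contra! hc
        nlinarith [mul_le_mul_of_nonneg_right hc hh.le]
      have e2 : (j:ℝ) < i + 1 := by
        have := hy.1.trans_lt hx.2
        by_contra! hc
        nlinarith [mul_le_mul_of_nonneg_right hc hh.le]
      have e1' : i < j + 1 := by exact_mod_cast e1
      have e2' : j < i + 1 := by exact_mod_cast e2
      omega
    · intro i _; exact measurableSet_Ico
  rw [← key]
  exact measure_mono (iUnion₂_subset hT)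

lemma ruzsa_step (A B : Set ℝ) (hAb : Bornology.IsBounded A) (hBb : Bornology.IsBounded B)
    (hA : A.Nonempty) (β D : ℝ) (hD : 0 < D) (hβ : β ∈ B) (hβ' : β + D ∈ B)
    (hB : B ⊆ Icc β (β + D)) (p : ℕ) (hp : p.Prime) :
    min (2 * volume A + volume B) (min (volume A + 2 * volume B) (volume A + ENNReal.ofReal D))
      ≤ volume (Metric.cthickening (2 * (D / p)) (A + B)) + 4 * ENNReal.ofReal (D / p) := by
  classical
  have hp0 : (0:ℝ) < p := by exact_mod_cast hp.pos
  set h := D / p with hh_def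
  have hh : 0 < h := by positivity
  have hph : p * h = D := by rw [hh_def]; field_simp
  set P := (ruzsa_floor_finite A hAb 0 h hh).toFinset with hP
  set Q := (ruzsa_floor_finite B hBb β h hh).toFinset with hQ
  have hPm : ∀ x ∈ A, ⌊(x - 0) / h⌋ ∈ P := fun x hx => by
    rw [hP, Set.Finite.mem_toFinset]; exact ⟨x, hx, rfl⟩
  have hQm : ∀ x ∈ B, ⌊(x - β) / h⌋ ∈ Q := fun x hx => by
    rw [hQ, Set.Finite.mem_toFinset]; exact ⟨x, hx, rfl⟩
  have hPv := ruzsa_cover A 0 h hh P hPm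
  have hQv := ruzsa_cover B β h hh Q hQm
  have hV : ((P + Q).card : ENNReal) * ENNReal.ofReal h
      ≤ volume (Metric.cthickening (2 * h) (A + B)) := by
    apply ruzsa_pack β h hh
    intro k hk t ht
    obtain ⟨i, hi, j, hj, rfl⟩ := Finset.mem_add.1 hk
    rw [hP, Set.Finite.mem_toFinset] at hi
    rw [hQ, Set.Finite.mem_toFinset] at hj
    obtain ⟨a, ha, rfl⟩ := hi
    obtain ⟨b, hb, rfl⟩ := hj
    apply Metric.mem_cthickening_of_dist_le t (a + b) _ _ (Set.add_mem_add ha hb)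
    have h1 := Int.floor_le ((a - 0) / h)
    have h2 := Int.lt_floor_add_one ((a - 0) / h)
    rw [le_div_iff₀ hh] at h1
    rw [div_lt_iff₀ hh] at h2
    have h3 := Int.floor_le ((b - β) / h)
    have h4 := Int.lt_floor_add_one ((b - β) / h)
    rw [le_div_iff₀ hh] at h3
    rw [div_lt_iff₀ hh] at h4
    obtain ⟨t1, t2⟩ := ht
    push_cast at t1 t2
    rw [Real.dist_eq, abs_le]
    constructor <;> nlinarith
  have hfin := ruzsa_finite p hp P Q
    (by obtain ⟨a, ha⟩ := hA; exact ⟨_, hPm a ha⟩)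
    (by
      intro b hb
      rw [hQ, Set.Finite.mem_toFinset] at hb
      obtain ⟨x, hx, rfl⟩ := hb
      have hx' := hB hx
      constructor
      · exact Int.floor_nonneg.2 (div_nonneg (by linarith [hx'.1]) hh.le)
      · have : (x - β) / h ≤ p := by rw [div_le_iff₀ hh]; linarith [hx'.2]
        have := Int.floor_le_floor this
        simpa using this)
    (by simpa using hQm β hβ)
    (by
      have := hQm _ hβ'
      have e : (β + D - β) / h = (p:ℝ) := by rw [div_eq_iff hh.ne']; linarith
      rw [e] at this
      simpa using this)
  set η := ENNReal.ofReal h with hη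
  set V := volume (Metric.cthickening (2 * h) (A + B))
  have hDη : ENNReal.ofReal D = p * η := by
    rw [← hph, ENNReal.ofReal_mul hp0.le, ENNReal.ofReal_natCast]
  rcases hfin with hc | hc | hc
  · refine (min_le_right _ _).trans ((min_le_right _ _).trans ?_)
    have hc' : (P.card : ENNReal) + p ≤ (P + Q).card := by exact_mod_cast hc
    calc volume A + ENNReal.ofReal D ≤ P.card * η + p * η := by rw [hDη]; gcongr
      _ = (P.card + p) * η := by ring
      _ ≤ (P + Q).card * η := by gcongr
      _ ≤ V := hV
      _ ≤ _ := le_self_add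
  · refine (min_le_left _ _).trans ?_
    have hc' : 2 * (P.card : ENNReal) + Q.card ≤ (P + Q).card + 4 := by
      exact_mod_cast hc.trans (by omega)
    calc 2 * volume A + volume B ≤ 2 * (P.card * η) + Q.card * η := by gcongr
      _ = (2 * P.card + Q.card) * η := by ring
      _ ≤ ((P + Q).card + 4) * η := by gcongr
      _ = (P + Q).card * η + 4 * η := by ring
      _ ≤ V + 4 * η := by gcongr
  · refine (min_le_right _ _).trans ((min_le_left _ _).trans ?_)
    have hc' : (P.card : ENNReal) + 2 * Q.card ≤ (P + Q).card + 4 := by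
      exact_mod_cast hc
    calc volume A + 2 * volume B ≤ P.card * η + 2 * (Q.card * η) := by gcongr
      _ = (P.card + 2 * Q.card) * η := by ring
      _ ≤ ((P + Q).card + 4) * η := by gcongr
      _ = (P + Q).card * η + 4 * η := by ring
      _ ≤ V + 4 * η := by gcongr

lemma ruzsa_compact (A B : Set ℝ) (hAc : IsCompact A) (hBc : IsCompact B)
    (hA : A.Nonempty) (β D : ℝ) (hD : 0 ≤ D) (hβ : β ∈ B) (hβ' : β + D ∈ B)
    (hB : B ⊆ Icc β (β + D)) :
    min (2 * volume A + volume B) (min (volume A + 2 * volume B) (volume A + ENNReal.ofReal D))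
      ≤ volume (A + B) := by
  rcases hD.eq_or_lt with rfl | hD
  · refine (min_le_right _ _).trans ((min_le_right _ _).trans ?_)
    simp only [ENNReal.ofReal_zero, add_zero]
    have : (fun x => x + β) '' A ⊆ A + B := by
      rintro _ ⟨x, hx, rfl⟩; exact Set.add_mem_add hx hβ
    refine le_trans (le_of_eq ?_) (measure_mono this)
    simp
  have hlim : Filter.Tendsto (fun n : ℕ => D / (n:ℝ)) Filter.atTop (nhds 0) :=
    tendsto_const_div_atTop_nhds_zero_nat D
  have hth := tendsto_measure_cthickening_of_isCompact (μ := volume) (hAc.add hBc)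
  have hlim2 : Filter.Tendsto (fun n : ℕ => 2 * (D / (n:ℝ))) Filter.atTop (nhds 0) := by
    simpa using hlim.const_mul 2
  have hl1 := hth.comp hlim2
  have hl2 : Filter.Tendsto (fun n : ℕ => 4 * ENNReal.ofReal (D / (n:ℝ))) Filter.atTop
      (nhds 0) := by
    have := ENNReal.Tendsto.const_mul (a := 4) (ENNReal.tendsto_ofReal hlim) (Or.inr (by simp))
    simpa using this
  have hl := hl1.add hl2
  rw [add_zero] at hl
  refine ge_of_tendsto_of_frequently hl ?_
  have hfr : ∃ᶠ n : ℕ in Filter.atTop, n.Prime := by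
    rw [Filter.frequently_atTop]
    intro n
    obtain ⟨p, h1, h2⟩ := Nat.exists_infinite_primes n
    exact ⟨p, h1, h2⟩
  exact hfr.mono fun p hp =>
    ruzsa_step A B hAc.isBounded hBc.isBounded hA β D hD hβ hβ' hB p hp

/-- **Ruzsa's lemma.** For bounded measurable sets `A`, `B` of reals with
`0 < μ(A) ≤ μ(B)`, one has `μ_*(A+B) ≥ min (2 μ(A) + μ(B)) (μ(A) + diam B)`. -/
theorem innerMeasure_add_ge (A B : Set ℝ)
    (hAb : Bornology.IsBounded A) (hBb : Bornology.IsBounded B)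
    (hAm : MeasurableSet A) (hBm : MeasurableSet B)
    (hA0 : 0 < volume A) (hAB : volume A ≤ volume B) :
    min (2 * volume A + volume B) (volume A + ENNReal.ofReal (sSup B - sInf B))
      ≤ innerMeasure (A + B) := by
  have hAne : A.Nonempty := nonempty_of_measure_ne_zero hA0.ne'
  have hBne : B.Nonempty := nonempty_of_measure_ne_zero (hA0.trans_le hAB).ne'
  have hmain : ∀ ε : ℝ, 0 < ε →
      min (2 * volume A + volume B) (volume A + ENNReal.ofReal (sSup B - sInf B))
      ≤ innerMeasure (A + B) + 3 * ENNReal.ofReal ε := by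
    intro ε hε
    have hε' : ENNReal.ofReal ε ≠ 0 := by simpa using hε
    obtain ⟨K, hKA, hK, hKv⟩ := hAm.exists_isCompact_lt_add (hAb.measure_lt_top (μ := volume)).ne hε'
    obtain ⟨L, hLB, hL, hLv⟩ := hBm.exists_isCompact_lt_add (hBb.measure_lt_top (μ := volume)).ne hε'
    obtain ⟨a, ha⟩ := hAne
    obtain ⟨b, hb, hb'⟩ := exists_lt_of_csInf_lt hBne (lt_add_of_pos_right (sInf B) hε)
    obtain ⟨c, hc, hc'⟩ := exists_lt_of_lt_csSup hBne (sub_lt_self (sSup B) hε)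
    set K' := insert a K with hK'
    set L' := insert b (insert c L) with hL'
    have hK'c : IsCompact K' := hK.insert a
    have hL'c : IsCompact L' := (hL.insert c).insert b
    have hK'A : K' ⊆ A := insert_subset ha hKA
    have hL'B : L' ⊆ B := insert_subset hb (insert_subset hc hLB)
    have hL'ne : L'.Nonempty := ⟨b, mem_insert _ _⟩
    have hlb : sInf L' ≤ b := csInf_le hL'c.bddBelow (mem_insert _ _)
    have hub : c ≤ sSup L' := le_csSup hL'c.bddAbove (mem_insert_of_mem _ (mem_insert _ _))
    have hle : sInf L' ≤ sSup L' := csInf_le_csSup hL'ne hL'c.bddBelow hL'c.bddAbove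
    have hcomp := ruzsa_compact K' L' hK'c hL'c ⟨a, mem_insert _ _⟩ (sInf L')
      (sSup L' - sInf L') (by linarith) (hL'c.sInf_mem hL'ne)
      (by simpa using hL'c.sSup_mem hL'ne)
      (fun x hx => ⟨csInf_le hL'c.bddBelow hx, by
        simpa using le_csSup hL'c.bddAbove hx⟩)
    have hin : volume (K' + L') ≤ innerMeasure (A + B) :=
      le_iSup₂_of_le (K' + L') (hK'c.add hL'c)
        (le_iSup_of_le (Set.add_subset_add hK'A hL'B) le_rfl)
    have vA : volume A ≤ volume K' + ENNReal.ofReal ε :=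
      hKv.le.trans (by gcongr; exact subset_insert _ _)
    have vB : volume B ≤ volume L' + ENNReal.ofReal ε :=
      hLv.le.trans (by gcongr; exact (subset_insert _ _).trans (subset_insert _ _))
    have vD : ENNReal.ofReal (sSup B - sInf B)
        ≤ ENNReal.ofReal (sSup L' - sInf L') + 2 * ENNReal.ofReal ε := by
      have : (2 : ENNReal) * ENNReal.ofReal ε = ENNReal.ofReal (2 * ε) := by
        rw [ENNReal.ofReal_mul (by norm_num)]; simp
      rw [this, ← ENNReal.ofReal_add (by linarith) (by linarith)]
      apply ENNReal.ofReal_le_ofReal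
      linarith
    refine le_trans ?_ (add_le_add_left (hcomp.trans hin) _)
    rw [min_add, min_add]
    refine le_min ?_ (le_min ?_ ?_)
    · refine (min_le_left _ _).trans ?_
      calc 2 * volume A + volume B
          ≤ 2 * (volume K' + ENNReal.ofReal ε) + (volume L' + ENNReal.ofReal ε) := by gcongr
        _ = _ := by ring
    · refine (min_le_left _ _).trans ?_
      calc 2 * volume A + volume B = volume A + volume A + volume B := by ring
        _ ≤ volume A + volume B + volume B := by gcongr
        _ ≤ (volume K' + ENNReal.ofReal ε) + (volume L' + ENNReal.ofReal ε)
            + (volume L' + ENNReal.ofReal ε) := by gcongr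
        _ = _ := by ring
    · refine (min_le_right _ _).trans ?_
      calc volume A + ENNReal.ofReal (sSup B - sInf B)
          ≤ (volume K' + ENNReal.ofReal ε)
            + (ENNReal.ofReal (sSup L' - sInf L') + 2 * ENNReal.ofReal ε) := by gcongr
        _ = _ := by ring
  have hl : Filter.Tendsto (fun n : ℕ => innerMeasure (A + B)
      + 3 * ENNReal.ofReal (1 / ((n:ℝ) + 1))) Filter.atTop (nhds (innerMeasure (A + B))) := by
    have := ENNReal.Tendsto.const_mul (a := 3)
      (ENNReal.tendsto_ofReal (tendsto_one_div_add_atTop_nhds_zero_nat (𝕜 := ℝ)))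
      (Or.inr (by simp))
    have := (tendsto_const_nhds (x := innerMeasure (A + B))).add this
    simpa using this
  exact ge_of_tendsto' hl fun n => hmain _ (by positivity)
end

section
/- Let A be a bounded measurable subset of ℝ with μ(A) > 0. Then the inner Lebesgue measure of A+A satisfies μ_*(A+A) ≥ min(3μ(A), μ(A) + diam(A)), where diam(A) = sup A − inf A. -/
open MeasureTheory Set
open scoped Pointwise

theorem circle_part (K : Set ℝ) (hK : IsCompact K) (a D : ℝ) (hD : 0 < D)
    (hne : K.Nonempty) (hab : K ⊆ Icc a (a + D)) (p : ℕ) (hp : p.Prime) :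
    min D (2 * volume.real K - D / p) ≤
      (volume.restrict (Icc (2*a) (2*a+D))).real
        (Metric.cthickening (2 * (D / p)) ((K + K) ∪ ((fun x => x - D) '' (K + K)))) := by
  classical
  have : Fact p.Prime := ⟨hp⟩
  have hp0 : (0:ℝ) < p := by exact_mod_cast hp.pos
  set h : ℝ := D / p with hh
  have hpos : 0 < h := by positivity
  have hph : (p:ℝ) * h = D := by rw [hh]; field_simp
  set B : Finset (ZMod p) := Finset.univ.filter
    (fun i => ∃ x ∈ K, a + h * (i.val : ℝ) ≤ x ∧ x ≤ a + h * (i.val + 1 : ℝ)) with hB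
  have hcov : ∀ x ∈ K, ∃ i ∈ B, x ∈ Icc (a + h * (i.val : ℝ)) (a + h * (i.val + 1 : ℝ)) := by
    intro x hx
    obtain ⟨hx1, hx2⟩ := hab hx
    have key : ∃ n : ℕ, n < p ∧ a + h * (n : ℝ) ≤ x ∧ x ≤ a + h * (n + 1 : ℝ) := by
      rcases hx2.lt_or_eq with hlt | heq
      · have h0 : 0 ≤ (x - a) / h := div_nonneg (by linarith) hpos.le
        refine ⟨⌊(x - a) / h⌋₊, ?_, ?_, ?_⟩
        · rw [Nat.floor_lt h0, div_lt_iff₀ hpos]; linarith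
        · have := Nat.floor_le h0
          rw [le_div_iff₀ hpos] at this; linarith
        · have := (Nat.lt_floor_add_one ((x - a) / h)).le
          rw [div_le_iff₀ hpos] at this; linarith
      · have hc : ((p - 1 : ℕ) : ℝ) = p - 1 := by
          rw [Nat.cast_sub hp.one_le]; simp
        refine ⟨p - 1, Nat.sub_lt hp.pos one_pos, ?_, ?_⟩ <;> rw [hc] <;> nlinarith
    obtain ⟨n, hn, h1, h2⟩ := key
    have hv : ((n : ZMod p)).val = n := ZMod.val_cast_of_lt hn
    refine ⟨(n : ZMod p), ?_, ?_⟩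
    · simp only [hB, Finset.mem_filter, Finset.mem_univ, true_and, hv]
      exact ⟨x, hx, h1, h2⟩
    · rw [hv]; exact ⟨h1, h2⟩
  have hBne : B.Nonempty := by
    obtain ⟨x, hx⟩ := hne
    obtain ⟨i, hi, _⟩ := hcov x hx
    exact ⟨i, hi⟩
  have hm : volume.real K ≤ B.card * h := by
    calc volume.real K ≤ volume.real (⋃ i ∈ B, Icc (a + h * (i.val : ℝ)) (a + h * (i.val + 1 : ℝ))) := by
          apply measureReal_mono
          · intro x hx
            obtain ⟨i, hi, hxi⟩ := hcov x hx
            simp only [mem_iUnion]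
            exact ⟨i, hi, hxi⟩
          · exact (B.isCompact_biUnion fun i _ => isCompact_Icc).measure_lt_top.ne
      _ ≤ ∑ i ∈ B, volume.real (Icc (a + h * (i.val : ℝ)) (a + h * (i.val + 1 : ℝ))) :=
          measureReal_biUnion_finset_le _ _
      _ = ∑ i ∈ B, h := by
          apply Finset.sum_congr rfl
          intro i _
          rw [Real.volume_real_Icc_of_le (by nlinarith)]; ring
      _ = _ := by simp
  have hcd := ZMod.cauchy_davenport hp hBne hBne
  have hcd' : min (p:ℝ) (2 * B.card - 1) ≤ ((B + B).card : ℝ) := by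
    have h1 : 1 ≤ B.card := hBne.card_pos
    rcases min_le_iff.1 hcd with h | h
    · exact min_le_iff.2 (Or.inl (by exact_mod_cast h))
    · refine min_le_iff.2 (Or.inr ?_)
      have : B.card + B.card ≤ (B+B).card + 1 := by omega
      have : (B.card + B.card : ℝ) ≤ (B+B).card + 1 := by exact_mod_cast this
      linarith
  have hvol : volume.real (⋃ k ∈ B + B, Ico (2*a + h * ((k.val : ℕ) : ℝ)) (2*a + h * (k.val + 1 : ℝ)))
      = (B + B).card * h := by
    rw [measureReal_biUnion_finset (h := fun b _ => (by rw [Real.volume_Ico]; exact ENNReal.ofReal_ne_top))]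
    · rw [Finset.sum_congr rfl (g := fun _ => h)]
      · simp
      · intro i _
        rw [Real.volume_real_Ico_of_le (by nlinarith)]; ring
    · intro i _ j _ hij
      have hne : i.val ≠ j.val := fun e => hij (ZMod.val_injective p e)
      rw [Function.onFun, Set.disjoint_left]
      rintro x ⟨h1, h2⟩ ⟨h3, h4⟩
      rcases lt_or_gt_of_ne hne with hl | hl
      · have : (i.val : ℝ) + 1 ≤ j.val := by exact_mod_cast hl
        nlinarith
      · have : (j.val : ℝ) + 1 ≤ i.val := by exact_mod_cast hl
        nlinarith
    · intro i _; exact measurableSet_Ico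
  have hfin : min D (2 * volume.real K - h) ≤ (B + B).card * h := by
    rcases min_le_iff.1 hcd' with h1 | h1
    · refine min_le_iff.2 (Or.inl ?_)
      nlinarith
    · refine min_le_iff.2 (Or.inr ?_)
      nlinarith
  refine hfin.trans ?_
  rw [← hvol, measureReal_restrict_apply' measurableSet_Icc]
  apply measureReal_mono
  · intro x hx
    simp only [mem_iUnion] at hx
    obtain ⟨k, hk, hx1, hx2⟩ := hx
    have hkp : (k.val : ℝ) + 1 ≤ p := by exact_mod_cast ZMod.val_lt k
    have hk0 : (0:ℝ) ≤ k.val := by positivity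
    refine ⟨?_, by nlinarith, by nlinarith⟩
    obtain ⟨i, hi, j, hj, rfl⟩ := Finset.mem_add.1 hk
    simp only [hB, Finset.mem_filter, Finset.mem_univ, true_and] at hi hj
    obtain ⟨u, hu, hu1, hu2⟩ := hi
    obtain ⟨v, hv, hv1, hv2⟩ := hj
    rcases lt_or_ge (i.val + j.val) p with hl | hl
    · have e : (((i + j).val : ℕ) : ℝ) = i.val + j.val := by
        rw [ZMod.val_add_of_lt hl]; push_cast; ring
      rw [e] at hx1 hx2
      refine Metric.mem_cthickening_of_dist_le x (u + v) _ _ (Or.inl (add_mem_add hu hv)) ?_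
      rw [Real.dist_eq, abs_le]; constructor <;> nlinarith
    · have e : (((i + j).val : ℕ) : ℝ) = i.val + j.val - p := by
        have := ZMod.val_add_val_of_le hl
        have : (i.val + j.val : ℝ) = (i+j).val + p := by exact_mod_cast this
        linarith
      rw [e] at hx1 hx2
      refine Metric.mem_cthickening_of_dist_le x (u + v - D) _ _
        (Or.inr ⟨u + v, add_mem_add hu hv, rfl⟩) ?_
      rw [Real.dist_eq, abs_le]; constructor <;> nlinarith
  · exact (measure_mono inter_subset_right |>.trans_lt isCompact_Icc.measure_lt_top).ne

theorem circle_lim (K : Set ℝ) (hK : IsCompact K) (a D : ℝ) (hD : 0 < D)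
    (hne : K.Nonempty) (hab : K ⊆ Icc a (a + D)) :
    min D (2 * volume.real K) ≤
      volume.real (((K + K) ∪ ((fun x => x - D) '' (K + K))) ∩ Icc (2*a) (2*a+D)) := by
  set T := (K + K) ∪ ((fun x => x - D) '' (K + K)) with hT
  have hTc : IsClosed T :=
    ((hK.add hK).union ((hK.add hK).image (by fun_prop))).isClosed
  choose p hp using fun n : ℕ => Nat.exists_infinite_primes n
  have hpt : Filter.Tendsto (fun n => D / (p n : ℝ)) Filter.atTop (nhds 0) := by
    apply Filter.Tendsto.div_atTop tendsto_const_nhds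
    exact tendsto_natCast_atTop_atTop.comp
      (Filter.tendsto_atTop_mono (fun n => (hp n).1) Filter.tendsto_id)
  have h1 : Filter.Tendsto (fun r => (volume.restrict (Icc (2*a) (2*a+D))) (Metric.cthickening r T))
      (nhds 0) (nhds ((volume.restrict (Icc (2*a) (2*a+D))) T)) :=
    tendsto_measure_cthickening_of_isClosed ⟨1, one_pos, measure_ne_top _ _⟩ hTc
  have h2 : Filter.Tendsto (fun r => (volume.restrict (Icc (2*a) (2*a+D))).real (Metric.cthickening r T))
      (nhds 0) (nhds ((volume.restrict (Icc (2*a) (2*a+D))).real T)) :=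
    (ENNReal.tendsto_toReal (measure_ne_top _ _)).comp h1
  have h3 := h2.comp (show Filter.Tendsto (fun n => 2 * (D / (p n : ℝ))) Filter.atTop (nhds 0) by
    simpa using hpt.const_mul 2)
  have h4 : Filter.Tendsto (fun n => min D (2 * volume.real K - D / p n)) Filter.atTop
      (nhds (min D (2 * volume.real K))) := by
    have := (tendsto_const_nhds (x := D)).min ((tendsto_const_nhds (x := 2 * volume.real K)).sub hpt)
    simpa using this
  rw [← measureReal_restrict_apply' measurableSet_Icc]
  exact le_of_tendsto_of_tendsto' h4 h3 fun n => circle_part K hK a D hD hne hab (p n) (hp n).2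

theorem compact_case (K : Set ℝ) (hK : IsCompact K) (a D : ℝ) (hD : 0 ≤ D)
    (ha : a ∈ K) (hb : a + D ∈ K) (hab : K ⊆ Icc a (a + D)) :
    min (3 * volume.real K) (volume.real K + D) ≤ volume.real (K + K) := by
  rcases hD.eq_or_lt with rfl | hD
  · have : volume.real K ≤ 0 := by
      have := measureReal_mono (μ := volume) hab (by simp)
      simpa [measureReal_def] using this
    exact (min_le_left _ _).trans ((by linarith : _ ≤ (0:ℝ)).trans measureReal_nonneg)
  have hc := circle_lim K hK a D hD ⟨a, ha⟩ hab
  set S := K + K with hS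
  have hSc : IsCompact S := hK.add hK
  set I := Icc (2*a) (2*a+D) with hI
  set S' := (fun x => x - D) '' S with hS'
  have hSc' : IsCompact S' := hSc.image (by fun_prop)
  have m1 : MeasurableSet (S ∩ I) := hSc.measurableSet.inter measurableSet_Icc
  have m2 : MeasurableSet (S' ∩ I) := hSc'.measurableSet.inter measurableSet_Icc
  have f0 : volume S ≠ ⊤ := hSc.measure_lt_top.ne
  have f0' : volume S' ≠ ⊤ := hSc'.measure_lt_top.ne
  have f1 : volume (S ∩ I) ≠ ⊤ := measure_ne_top_of_subset inter_subset_left f0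
  have f2 : volume (S' ∩ I) ≠ ⊤ := measure_ne_top_of_subset inter_subset_left f0'
  have e1 := measureReal_union_add_inter (μ := volume) (s := S ∩ I) m2 f1 f2
  rw [← union_inter_distrib_right] at e1
  have e2 : volume.real K ≤ volume.real ((S ∩ I) ∩ (S' ∩ I)) := by
    have : volume.real ((fun x => a + x) '' K) = volume.real K := by
      simp only [measureReal_def, image_add_left, measure_preimage_add]
    rw [← this]
    apply measureReal_mono _ (measure_ne_top_of_subset inter_subset_left f1)
    rintro _ ⟨x, hx, rfl⟩
    have := hab hx
    have hxI : a + x ∈ I := ⟨by linarith [this.1], by linarith [this.2]⟩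
    exact ⟨⟨add_mem_add ha hx, hxI⟩, ⟨(a + D) + x, add_mem_add hb hx, by ring⟩, hxI⟩
  have e3 : volume.real (S' ∩ I) ≤ volume.real (S \ Iio (2*a+D)) := by
    have : volume.real ((fun x => D + x) '' (S' ∩ I)) = volume.real (S' ∩ I) := by
      simp only [measureReal_def, image_add_left, measure_preimage_add]
    rw [← this]
    apply measureReal_mono _ (measure_ne_top_of_subset diff_subset f0)
    rintro _ ⟨_, ⟨⟨x, hx, rfl⟩, hxI⟩, rfl⟩
    have := hxI.1
    simp only [add_sub_cancel, mem_diff, mem_Iio, not_lt] at *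
    exact ⟨hx, by linarith⟩
  have e4 : volume.real (S ∩ I) ≤ volume.real (S ∩ Iio (2*a+D)) := by
    have hsub : S ∩ I ⊆ (S ∩ Iio (2*a+D)) ∪ {2*a+D} := by
      rintro x ⟨hx, hxI⟩
      rcases hxI.2.lt_or_eq with h | h
      · exact Or.inl ⟨hx, h⟩
      · exact Or.inr h
    have f3 : volume (S ∩ Iio (2*a+D)) ≠ ⊤ := measure_ne_top_of_subset inter_subset_left f0
    refine (measureReal_mono hsub (measure_union_ne_top f3 (by simp))).trans ?_
    refine (measureReal_union_le _ _).trans ?_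
    simp [measureReal_def]
  have e5 := measureReal_inter_add_diff (μ := volume) (s := S) (t := Iio (2*a+D)) measurableSet_Iio f0
  rcases min_le_iff.1 hc with h | h
  · exact min_le_iff.2 (Or.inr (by linarith))
  · exact min_le_iff.2 (Or.inl (by linarith))

/-- **Ruzsa's lemma, symmetric form.** For a bounded measurable set `A` of reals of
positive measure, `μ_*(A+A) ≥ min (3 μ(A)) (μ(A) + diam A)`. -/
theorem innerMeasure_self_add_ge (A : Set ℝ)
    (hAb : Bornology.IsBounded A) (hAm : MeasurableSet A) (hA0 : 0 < volume A) :
    min (3 * volume A) (volume A + ENNReal.ofReal (sSup A - sInf A))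
      ≤ innerMeasure (A + A) := by
  have hfin : volume A ≠ ⊤ := hAb.measure_lt_top.ne
  have hne : A.Nonempty := nonempty_of_measure_ne_zero hA0.ne'
  have hD : 0 ≤ sSup A - sInf A := sub_nonneg.2 (Real.sInf_le_sSup A hAb.bddBelow hAb.bddAbove)
  have hlhs : min (3 * volume A) (volume A + ENNReal.ofReal (sSup A - sInf A)) =
      ENNReal.ofReal (min (3 * volume.real A) (volume.real A + (sSup A - sInf A))) := by
    rw [ENNReal.ofReal_min, ENNReal.ofReal_mul (by norm_num),
      ENNReal.ofReal_add measureReal_nonneg hD, ofReal_measureReal hfin]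
    simp
  rw [hlhs]
  refine ENNReal.le_of_forall_pos_le_add fun δ hδ _ => ?_
  set ε : ℝ := (δ : ℝ) / 3 with hε
  have hδ' : (0:ℝ) < δ := hδ
  have hεp : 0 < ε := by positivity
  obtain ⟨K, hKA, hK, hKm⟩ := hAm.exists_isCompact_lt_add hfin
    (ENNReal.ofReal_pos.2 hεp).ne'
  obtain ⟨x, hx, hx'⟩ := exists_lt_of_csInf_lt hne (show sInf A < sInf A + ε by linarith)
  obtain ⟨y, hy, hy'⟩ := exists_lt_of_lt_csSup hne (show sSup A - ε < sSup A by linarith)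
  set L : Set ℝ := K ∪ {x, y} with hL
  have hLc : IsCompact L := hK.union (Set.toFinite {x, y}).isCompact
  have hLA : L ⊆ A := by
    refine union_subset hKA ?_
    rintro z (rfl | rfl) <;> assumption
  have hxL : x ∈ L := Or.inr (by simp)
  have hyL : y ∈ L := Or.inr (by simp)
  have h1 := hLc.sInf_mem ⟨x, hxL⟩
  have h2 := hLc.sSup_mem ⟨x, hxL⟩
  have h3 := csInf_le hLc.bddBelow hxL
  have h4 := le_csSup hLc.bddAbove hyL
  have hm : volume.real A ≤ volume.real L + ε := by
    have h5 : volume A ≤ volume L + ENNReal.ofReal ε :=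
      hKm.le.trans (by gcongr; exact subset_union_left)
    have := ENNReal.toReal_mono
      (ENNReal.add_ne_top.2 ⟨hLc.measure_lt_top.ne, ENNReal.ofReal_ne_top⟩) h5
    rwa [ENNReal.toReal_add hLc.measure_lt_top.ne ENNReal.ofReal_ne_top,
      ENNReal.toReal_ofReal hεp.le] at this
  have hc := compact_case L hLc (sInf L) (sSup L - sInf L)
    (sub_nonneg.2 (csInf_le hLc.bddBelow h2)) h1 (by simpa using h2)
    (fun z hz => ⟨csInf_le hLc.bddBelow hz, by simpa using le_csSup hLc.bddAbove hz⟩)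
  have hmain : min (3 * volume.real A) (volume.real A + (sSup A - sInf A))
      ≤ volume.real (L + L) + δ := by
    rcases min_le_iff.1 hc with h | h
    · exact min_le_iff.2 (Or.inl (by linarith))
    · exact min_le_iff.2 (Or.inr (by linarith))
  refine (ENNReal.ofReal_le_ofReal hmain).trans ?_
  rw [ENNReal.ofReal_add measureReal_nonneg hδ'.le,
    ofReal_measureReal (hLc.add hLc).measure_lt_top.ne, ENNReal.ofReal_coe_nnreal]
  gcongr
  unfold innerMeasure
  exact le_iSup_of_le (L + L) (le_iSup_of_le (hLc.add hLc)
    (le_iSup_of_le (add_subset_add hLA hLA) le_rfl))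
end

section
/- Let A be a nonempty bounded measurable 3-sum-free subset of the nonnegative reals. Then μ(A) ≤ (2·sup A − inf A)/4. -/
open MeasureTheory Set

lemma aux_ne_top {S : Set ℝ} {p q : ℝ} (h : S ⊆ Icc p q) : volume S ≠ ⊤ :=
  ((measure_mono h).trans_lt measure_Icc_lt_top).ne

lemma aux_half (A : Set ℝ) (hA : MeasurableSet A) (p q : ℝ) (hpq : p ≤ q)
    (h : ∀ x ∈ A, p + q - x ∉ A) : volume.real (A ∩ Icc p q) ≤ (q - p) / 2 := by
  have hS : MeasurableSet (A ∩ Icc p q) := hA.inter measurableSet_Icc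
  set S := A ∩ Icc p q with hSdef
  have hSI : S ⊆ Icc p q := inter_subset_right
  have hR : (fun x => p + q - x) ⁻¹' S ⊆ Icc p q := by
    rintro x ⟨_, h1, h2⟩
    constructor <;> linarith
  have hm : volume.real ((fun x => p + q - x) ⁻¹' S) = volume.real S := by
    simp only [measureReal_def]
    rw [(Measure.measurePreserving_sub_left volume (p + q)).measure_preimage hS.nullMeasurableSet]
  have hd : Disjoint S ((fun x => p + q - x) ⁻¹' S) := by
    rw [Set.disjoint_left]
    intro x hx hx'
    exact h x hx.1 hx'.1
  have hu := measureReal_union₀ (μ := volume) (s := S) (t := (fun x => p + q - x) ⁻¹' S)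
    ((measurable_const.sub measurable_id) hS).nullMeasurableSet hd.aedisjoint
    (aux_ne_top hSI) (aux_ne_top hR)
  have hle := measureReal_mono (μ := volume) (union_subset hSI hR) (by simp)
  rw [hu, hm, Real.volume_real_Icc_of_le hpq] at hle
  linarith

lemma aux_core (A : Set ℝ) (hA : MeasurableSet A) (a D : ℝ) (ha0 : 0 ≤ a) (haA : a ∈ A)
    (hDA : D ∈ A) (hsub : A ⊆ Icc a D)
    (hsf : ∀ x ∈ A, ∀ y ∈ A, ∀ z ∈ A, x + y ≠ 3 * z) :
    volume.real A ≤ (2 * D - a) / 4 := by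
  have haD : a ≤ D := (hsub haA).2
  by_contra! hcon
  have hcov : ∀ t ∈ Icc (2 * a) (a + D),
      (∃ x ∈ A, t - x ∈ A) ∨ (∃ x ∈ A, t + (D - a) - x ∈ A) := by
    rintro t ⟨h1, h2⟩
    by_contra! hn
    have e1 := aux_half A hA a (t - a) (by linarith) (by
      intro x hx
      have := hn.1 x hx
      rwa [show a + (t - a) - x = t - x by ring])
    have e2 := aux_half A hA (t - a) D (by linarith) (by
      intro x hx
      have := hn.2 x hx
      rwa [show (t - a) + D - x = t + (D - a) - x by ring])
    have e3 : volume.real A ≤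
        volume.real (A ∩ Icc a (t - a)) + volume.real (A ∩ Icc (t - a) D) := by
      refine le_trans (measureReal_mono ?_ ?_) (measureReal_union_le _ _)
      · intro x hx
        rcases le_total x (t - a) with h | h
        · exact Or.inl ⟨hx, (hsub hx).1, h⟩
        · exact Or.inr ⟨hx, h, (hsub hx).2⟩
      · exact aux_ne_top (p := a) (q := D)
          (union_subset (inter_subset_left.trans hsub) (inter_subset_left.trans hsub))
    linarith
  set B : Set ℝ := (fun t => (1 / 3 : ℝ) * t) ⁻¹' A with hBdef
  have hB : MeasurableSet B := (measurable_const_mul (1 / 3 : ℝ)) hA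
  have hBv : volume.real B = 3 * volume.real A := by
    simp only [measureReal_def, hBdef]
    rw [Real.volume_preimage_mul_left (by norm_num), ENNReal.toReal_mul]
    norm_num
  have hBA : ∀ t ∈ B, ∀ x ∈ A, t - x ∉ A := by
    intro t ht x hx hy
    exact hsf x hx _ hy _ ht (by ring)
  set I := Icc (2 * a) (a + D)
  set B1 := B ∩ I
  set B2 := (fun t => t + (D - a)) ⁻¹' B ∩ I
  set A2 := (fun t => t + (-a)) ⁻¹' A
  have hB1 : MeasurableSet B1 := hB.inter measurableSet_Icc
  have hB2 : MeasurableSet B2 := ((measurable_add_const (D - a)) hB).inter measurableSet_Icc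
  have hA2 : MeasurableSet A2 := (measurable_add_const (-a)) hA
  have hB1I : B1 ⊆ I := inter_subset_right
  have hB2I : B2 ⊆ I := inter_subset_right
  have hA2I : A2 ⊆ I := by
    intro x hx
    have := hsub hx
    constructor <;> linarith [this.1, this.2]
  have hA2v : volume.real A2 = volume.real A := by
    simp only [measureReal_def, A2]
    rw [measure_preimage_add_right]
  have d12 : Disjoint B1 B2 := by
    rw [Set.disjoint_left]
    intro t h1 h2
    rcases hcov t h1.2 with ⟨x, hx, hy⟩ | ⟨x, hx, hy⟩
    · exact hBA t h1.1 x hx hy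
    · exact hBA _ h2.1 x hx hy
  have d3 : Disjoint (B1 ∪ B2) A2 := by
    rw [Set.disjoint_left]
    rintro t (h1 | h2) h3
    · exact hBA t h1.1 a haA h3
    · refine hBA _ h2.1 D hDA ?_
      have h3' : t + (-a) ∈ A := h3
      rwa [show t + (D - a) - D = t + (-a) by ring]
  have s1 := measureReal_union (μ := volume) d12 hB2 (aux_ne_top hB1I) (aux_ne_top hB2I)
  have s2 := measureReal_union (μ := volume) d3 hA2
    (aux_ne_top (union_subset hB1I hB2I)) (aux_ne_top hA2I)
  have s3 := measureReal_mono (μ := volume)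
    (union_subset (union_subset hB1I hB2I) hA2I) (aux_ne_top subset_rfl)
  rw [s2, s1, hA2v, Real.volume_real_Icc_of_le (by linarith)] at s3
  set C := (fun t => t + (-(D - a))) ⁻¹' B2
  have hCv : volume.real C = volume.real B2 := by
    simp only [measureReal_def, C]
    rw [measure_preimage_add_right]
  have hC : C ⊆ Icc (a + D) (2 * D) := by
    intro t ht
    have := hB2I ht
    constructor <;> linarith [this.1, this.2]
  have s4 : volume.real B ≤ volume.real ((B1 ∪ C) ∪ Icc (2 * D) (3 * D)) := by
    refine measureReal_mono ?_ ?_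
    · intro t ht
      have h := hsub ht
      have h1 := h.1
      have h2 := h.2
      rcases le_total t (a + D) with h3 | h3
      · exact Or.inl (Or.inl ⟨ht, by linarith, h3⟩)
      · rcases le_total t (2 * D) with h4 | h4
        · refine Or.inl (Or.inr ⟨?_, ?_, ?_⟩)
          · change t + (-(D - a)) + (D - a) ∈ B
            rwa [show t + (-(D - a)) + (D - a) = t by ring]
          · change 2 * a ≤ t + (-(D - a))
            linarith
          · change t + (-(D - a)) ≤ a + D
            linarith
        · exact Or.inr ⟨h4, by linarith⟩
    · refine aux_ne_top (p := 2 * a) (q := 3 * D) (union_subset (union_subset ?_ ?_) ?_)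
      · exact hB1I.trans (Icc_subset_Icc le_rfl (by linarith))
      · exact hC.trans (Icc_subset_Icc (by linarith) (by linarith))
      · exact Icc_subset_Icc (by linarith) le_rfl
  have s5 := measureReal_union_le (μ := volume) (B1 ∪ C) (Icc (2 * D) (3 * D))
  have s6 := measureReal_union_le (μ := volume) B1 C
  rw [Real.volume_real_Icc_of_le (by linarith)] at s5
  linarith

/-- **Lemma (Matolcsi–Ruzsa).** If `A` is a nonempty bounded measurable 3-sum-free set
of nonnegative reals, then `μ(A) ≤ (2 sup A − inf A)/4`. -/
theorem measure_le_of_three_sum_free_nonneg (A : Set ℝ)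
    (hne : A.Nonempty) (hb : Bornology.IsBounded A) (hmeas : MeasurableSet A)
    (hpos : ∀ x ∈ A, 0 ≤ x)
    (hsf : ∀ x ∈ A, ∀ y ∈ A, ∀ z ∈ A, x + y ≠ 3 * z) :
    (volume A).toReal ≤ (2 * sSup A - sInf A) / 4 := by
  refine le_of_forall_pos_le_add fun ε hε => ?_
  have hbb : BddBelow A := hb.bddBelow
  have hba : BddAbove A := hb.bddAbove
  obtain ⟨a₀, ha₀, ha₀'⟩ := exists_lt_of_csInf_lt hne (show sInf A < sInf A + ε / 2 by linarith)
  obtain ⟨d₀, hd₀, hd₀'⟩ := exists_lt_of_lt_csSup hne (show sSup A - ε / 2 < sSup A by linarith)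
  obtain ⟨a, D, ha, hD, haD, ha', hD'⟩ : ∃ a D, a ∈ A ∧ D ∈ A ∧ a ≤ D ∧
      a < sInf A + ε / 2 ∧ sSup A - ε / 2 < D := by
    rcases le_total a₀ d₀ with h | h
    · exact ⟨a₀, d₀, ha₀, hd₀, h, ha₀', hd₀'⟩
    · exact ⟨a₀, a₀, ha₀, ha₀, le_rfl, ha₀', by linarith⟩
  have h1 := aux_core (A ∩ Icc a D) (hmeas.inter measurableSet_Icc) a D (hpos a ha)
    ⟨ha, le_rfl, haD⟩ ⟨hD, haD, le_rfl⟩ inter_subset_right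
    (fun x hx y hy z hz => hsf x hx.1 y hy.1 z hz.1)
  have ia := csInf_le hbb ha
  have sD := le_csSup hba hD
  have h2 : volume.real A ≤
      volume.real ((A ∩ Icc a D) ∪ (Icc (sInf A) a ∪ Icc D (sSup A))) := by
    refine measureReal_mono ?_ ?_
    · intro x hx
      have x1 := csInf_le hbb hx
      have x2 := le_csSup hba hx
      rcases le_total x a with h | h
      · exact Or.inr (Or.inl ⟨x1, h⟩)
      · rcases le_total x D with h' | h'
        · exact Or.inl ⟨hx, h, h'⟩
        · exact Or.inr (Or.inr ⟨h', x2⟩)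
    · refine aux_ne_top (p := sInf A) (q := sSup A) (union_subset ?_ (union_subset ?_ ?_))
      · exact inter_subset_right.trans (Icc_subset_Icc ia sD)
      · exact Icc_subset_Icc le_rfl (by linarith)
      · exact Icc_subset_Icc (by linarith) le_rfl
  have h3 := measureReal_union_le (μ := volume) (A ∩ Icc a D)
    (Icc (sInf A) a ∪ Icc D (sSup A))
  have h4 := measureReal_union_le (μ := volume) (Icc (sInf A) a) (Icc D (sSup A))
  rw [Real.volume_real_Icc_of_le ia, Real.volume_real_Icc_of_le sD] at h4
  change volume.real A ≤ _
  linarith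
end

section
/- Let A be a measurable 3-sum-free subset of [0,1] with sup A = 1. Then μ(A) ≤ 1/3 + (1/2)·μ(A ∩ [2/3, 1]). -/
open MeasureTheory Set
open scoped Pointwise

lemma aux_int (p : ℕ) (hp : p.Prime) (T : Finset ℕ) (hT : ∀ t ∈ T, t ≤ p) (h0 : 0 ∈ T)
    (hpT : p ∈ T) :
    min p (2 * (T.erase p).card - 1) + (T.erase p).card ≤ (T + T).card := by
  set T' := T.erase p with hT'
  have hlt : ∀ t ∈ T', t < p := fun t ht => by
    rw [hT', Finset.mem_erase] at ht
    exact lt_of_le_of_ne (hT t ht.2) ht.1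
  have h0' : 0 ∈ T' := by
    rw [hT', Finset.mem_erase]; exact ⟨hp.pos.ne, h0⟩
  have hsub : T' ⊆ T := Finset.erase_subset _ _
  let B : Finset (ZMod p) := T'.image (fun n : ℕ => (n : ZMod p))
  have hB : B.card = T'.card := by
    apply Finset.card_image_of_injOn
    intro a ha b hb hab
    have := (ZMod.natCast_eq_natCast_iff' a b p).1 hab
    rwa [Nat.mod_eq_of_lt (hlt a ha), Nat.mod_eq_of_lt (hlt b hb)] at this
  have hBn : B.Nonempty := ⟨_, Finset.mem_image_of_mem _ h0'⟩
  have hcd := ZMod.cauchy_davenport hp hBn hBn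
  rw [hB] at hcd
  let U : Finset ℕ := T'.image (fun n => n + p)
  have hU : U.card = T'.card := Finset.card_image_of_injective _ (add_left_injective p)
  have hUS : U ⊆ T + T := by
    intro u hu
    obtain ⟨t, ht, rfl⟩ := Finset.mem_image.1 hu
    exact Finset.add_mem_add (hsub ht) hpT
  have hsurj : B + B ⊆ ((T + T) \ U).image (fun n : ℕ => (n : ZMod p)) := by
    intro x hx
    obtain ⟨a, ha, b, hb, rfl⟩ := Finset.mem_add.1 hx
    obtain ⟨s, hs, rfl⟩ := Finset.mem_image.1 ha
    obtain ⟨t, ht, rfl⟩ := Finset.mem_image.1 hb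
    rw [Finset.mem_image]
    by_cases h : s + t ∈ U
    · obtain ⟨r, hr, hr'⟩ := Finset.mem_image.1 h
      refine ⟨r, ?_, ?_⟩
      · rw [Finset.mem_sdiff]
        constructor
        · simpa using Finset.add_mem_add (hsub hr) h0
        · intro h2
          obtain ⟨q, hq, hq'⟩ := Finset.mem_image.1 h2
          have := hlt r hr
          omega
      · have := congrArg (fun n : ℕ => (n : ZMod p)) hr'
        simpa using this
    · exact ⟨s + t, Finset.mem_sdiff.2 ⟨Finset.add_mem_add (hsub hs) (hsub ht), h⟩, by simp⟩
  have h1 := (Finset.card_le_card hsurj).trans Finset.card_image_le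
  have h2 := Finset.card_sdiff_add_card_eq_card hUS
  omega

lemma aux_cells (K : Set ℝ) (hK : IsCompact K) (m M : ℝ) (hmK : m ∈ K) (hMK : M ∈ K)
    (hsub : K ⊆ Icc m M) (hmM : m < M) (p : ℕ) (hp : p.Prime) :
    min (M - m) (2 * volume.real K - (M - m) / p) + volume.real K
      ≤ volume.real (Metric.cthickening (2 * ((M - m) / p)) (K + K)) := by
  classical
  have hp0 : (0 : ℝ) < p := by exact_mod_cast hp.pos
  set h : ℝ := (M - m) / p with hh
  have hpos : 0 < h := div_pos (sub_pos.2 hmM) hp0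
  have hph : (p : ℝ) * h = M - m := by rw [hh]; field_simp
  let T : Finset ℕ := (Finset.range (p + 1)).filter
    (fun i => ∃ a ∈ K, m + i * h ≤ a ∧ a < m + (i + 1) * h)
  have hTm : ∀ i, i ∈ T ↔ i < p + 1 ∧ ∃ a ∈ K, m + i * h ≤ a ∧ a < m + (i + 1) * h := by
    intro i; simp [T]
  have h0T : 0 ∈ T := (hTm 0).2 ⟨by omega, m, hmK, by simp, by simp; exact hpos⟩
  have hpT : p ∈ T := (hTm p).2 ⟨by omega, M, hMK, by linarith, by nlinarith⟩
  have hint := aux_int p hp T (fun t ht => by have := ((hTm t).1 ht).1; omega) h0T hpT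
  set k := (T.erase p).card with hk
  have hk1 : 1 ≤ k := Finset.card_pos.2 ⟨0, Finset.mem_erase.2 ⟨hp.pos.ne, h0T⟩⟩
  have hvol : volume.real K ≤ k * h := by
    have hcov : K ⊆ (⋃ i ∈ T.erase p, Ico (m + (i : ℝ) * h) (m + (i + 1) * h)) ∪ {M} := by
      intro x hx
      by_cases hxM : x = M
      · right; exact hxM
      left
      have hxm := hsub hx
      have hxlt : x < M := lt_of_le_of_ne hxm.2 hxM
      have hnn : 0 ≤ (x - m) / h := div_nonneg (sub_nonneg.2 hxm.1) hpos.le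
      have hlo := Nat.floor_le hnn
      have hhi := Nat.lt_floor_add_one ((x - m) / h)
      set i := ⌊(x - m) / h⌋₊
      rw [le_div_iff₀ hpos] at hlo
      rw [div_lt_iff₀ hpos] at hhi
      have hip : i < p := by
        have : (i : ℝ) * h < p * h := by linarith
        exact_mod_cast lt_of_mul_lt_mul_right this hpos.le
      simp only [mem_iUnion]
      exact ⟨i, Finset.mem_erase.2 ⟨hip.ne, (hTm i).2 ⟨by omega, x, hx, by linarith, by linarith⟩⟩,
        by constructor <;> linarith⟩
    have hfin : volume ((⋃ i ∈ T.erase p, Ico (m + (i : ℝ) * h) (m + (i + 1) * h)) ∪ {M}) ≠ ⊤ := by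
      have hb : Bornology.IsBounded
          ((⋃ i ∈ T.erase p, Ico (m + (i : ℝ) * h) (m + (i + 1) * h)) ∪ {M}) := by
        refine Bornology.IsBounded.union ?_ Bornology.isBounded_singleton
        exact (Bornology.isBounded_biUnion_finset _).2 fun i _ => Metric.isBounded_Ico _ _
      exact hb.measure_lt_top.ne
    calc volume.real K ≤ _ := measureReal_mono hcov hfin
      _ ≤ _ := measureReal_union_le _ _
      _ ≤ (∑ i ∈ T.erase p, volume.real (Ico (m + (i : ℝ) * h) (m + (i + 1) * h)))
          + volume.real {M} := by
        gcongr; exact measureReal_biUnion_finset_le _ _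
      _ = k * h := by
        have : ∀ i : ℕ, volume.real (Ico (m + (i : ℝ) * h) (m + (i + 1) * h)) = h := by
          intro i
          rw [Real.volume_real_Ico_of_le (by nlinarith)]; ring
        have hz : volume.real {M} = 0 := by simp [Measure.real]
        rw [hz, Finset.sum_congr rfl (fun i _ => this i)]
        simp [hk]
  have hS : ((T + T).card : ℝ) * h ≤ volume.real (Metric.cthickening (2 * h) (K + K)) := by
    have hsubS : (⋃ s ∈ T + T, Ico (2 * m + (s : ℝ) * h) (2 * m + (s + 1) * h)) ⊆
        Metric.cthickening (2 * h) (K + K) := by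
      intro x hx
      simp only [mem_iUnion] at hx
      obtain ⟨s, hs, hx1, hx2⟩ := hx
      obtain ⟨i, hi, j, hj, rfl⟩ := Finset.mem_add.1 hs
      obtain ⟨-, a, ha, ha1, ha2⟩ := (hTm i).1 hi
      obtain ⟨-, b, hb, hb1, hb2⟩ := (hTm j).1 hj
      push_cast at hx1 hx2
      refine Metric.mem_cthickening_of_dist_le x (a + b) _ _ (Set.add_mem_add ha hb) ?_
      rw [Real.dist_eq, abs_le]
      constructor <;> nlinarith
    have hfin : volume (Metric.cthickening (2 * h) (K + K)) ≠ ⊤ :=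
      (hK.add hK).isBounded.cthickening.measure_lt_top.ne
    refine le_trans (le_of_eq ?_) (measureReal_mono hsubS hfin)
    rw [measureReal_biUnion_finset ?_ ?_ (fun _ _ => measure_Ico_lt_top.ne)]
    · have : ∀ i : ℕ, volume.real (Ico (2 * m + (i : ℝ) * h) (2 * m + (i + 1) * h)) = h := by
        intro i
        rw [Real.volume_real_Ico_of_le (by nlinarith)]; ring
      simp [this]
    · intro i _ j _ hij
      rw [Function.onFun, Set.disjoint_left]
      rintro x ⟨hx1, hx2⟩ ⟨hx3, hx4⟩
      rcases lt_or_gt_of_ne hij with hl | hl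
      · have : (i : ℝ) + 1 ≤ j := by exact_mod_cast hl
        nlinarith
      · have : (j : ℝ) + 1 ≤ i := by exact_mod_cast hl
        nlinarith
    · intro _ _; exact measurableSet_Ico
  refine le_trans ?_ hS
  have hint' : min (p : ℝ) (2 * k - 1) + k ≤ (T + T).card := by
    have : ((min p (2 * k - 1) + k : ℕ) : ℝ) ≤ (T + T).card := by exact_mod_cast hint
    rw [Nat.cast_add, Nat.cast_min, Nat.cast_sub (by omega)] at this
    push_cast at this
    exact this
  have := mul_le_mul_of_nonneg_right hint' hpos.le
  rw [add_mul, min_mul_of_nonneg _ _ hpos.le, hph] at this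
  refine le_trans ?_ this
  gcongr
  linarith

lemma aux_sum (K : Set ℝ) (hK : IsCompact K) (m M : ℝ) (hmK : m ∈ K) (hMK : M ∈ K)
    (hsub : K ⊆ Icc m M) (hmM : m < M) :
    min (M - m) (2 * volume.real K) + volume.real K ≤ volume.real (K + K) := by
  have ht : Filter.Tendsto (fun r => volume.real (Metric.cthickening r (K + K)))
      (nhds 0) (nhds (volume.real (K + K))) :=
    (ENNReal.tendsto_toReal (hK.add hK).measure_lt_top.ne).comp
      (tendsto_measure_cthickening_of_isCompact (hK.add hK))
  obtain ⟨q, hq⟩ : ∃ q : ℕ → ℕ, ∀ n, n ≤ q n ∧ (q n).Prime :=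
    ⟨_, fun n => Classical.choose_spec (Nat.exists_infinite_primes n)⟩
  have hq1 : Filter.Tendsto q Filter.atTop Filter.atTop :=
    Filter.tendsto_atTop_mono (fun n => (hq n).1) Filter.tendsto_id
  have hh : Filter.Tendsto (fun n => (M - m) / (q n : ℝ)) Filter.atTop (nhds 0) :=
    (tendsto_const_div_atTop_nhds_zero_nat (M - m)).comp hq1
  have h2 : Filter.Tendsto (fun n => 2 * ((M - m) / (q n : ℝ))) Filter.atTop (nhds 0) := by
    simpa using hh.const_mul 2
  have h3 : Filter.Tendsto
      (fun n => min (M - m) (2 * volume.real K - (M - m) / (q n : ℝ)) + volume.real K)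
      Filter.atTop (nhds (min (M - m) (2 * volume.real K - 0) + volume.real K)) :=
    (tendsto_const_nhds.min (tendsto_const_nhds.sub hh)).add tendsto_const_nhds
  rw [sub_zero] at h3
  exact le_of_tendsto_of_tendsto' h3 (ht.comp h2) fun n =>
    aux_cells K hK m M hmK hMK hsub hmM (q n) (hq n).2

lemma aux_compact (K : Set ℝ) (hK : IsCompact K) (m M : ℝ) (hmK : m ∈ K) (hMK : M ∈ K)
    (hsub : K ⊆ Icc m M) (hm : 0 ≤ m) (hM : M ≤ 1) 
    (hsf : ∀ x ∈ K, ∀ y ∈ K, ∀ z ∈ K, x + y ≠ 3 * z) :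
    volume.real K ≤ 1 / 3 + (1 - M) / 4 + (1 / 2) * volume.real (K ∩ Icc (2/3 : ℝ) 1) := by
  rcases (hsub hmK).2.eq_or_lt with rfl | hmM
  · have : volume.real K ≤ 0 := by
      have := measureReal_mono (μ := volume) hsub (by simp)
      simpa [Measure.real] using this
    have h2 : 0 ≤ volume.real (K ∩ Icc (2/3 : ℝ) 1) := measureReal_nonneg
    linarith
  have hS := aux_sum K hK m M hmK hMK hsub hmM
  have hKm := hK.measurableSet
  have hKf : volume K ≠ ⊤ := hK.measure_lt_top.ne
  have hsplit : volume.real K = volume.real (K \ Icc (2/3 : ℝ) 1)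
      + volume.real (K ∩ Icc (2/3 : ℝ) 1) := by
    rw [add_comm, measureReal_inter_add_sdiff measurableSet_Icc hKf]
  have hkb : volume.real (K ∩ Icc (2/3 : ℝ) 1) ≤ 1 / 3 := by
    have := measureReal_mono (μ := volume) (inter_subset_right : K ∩ Icc (2/3 : ℝ) 1 ⊆ _) (by simp)
    rw [Real.volume_real_Icc_of_le (by norm_num)] at this
    linarith
  have hsm : volume.real ((1 / 3 : ℝ) • (K + K)) = (1 / 3) * volume.real (K + K) := by
    rw [Measure.real, Measure.addHaar_smul, ENNReal.toReal_mul, Measure.real]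
    norm_num [abs_of_pos]
  have hmain : volume.real (K \ Icc (2/3 : ℝ) 1) + (1 / 3) * volume.real (K + K)
      ≤ 2 / 3 - 2 / 3 * m := by
    have hc : IsCompact ((1 / 3 : ℝ) • (K + K)) := (hK.add hK).smul _
    rw [← hsm, ← measureReal_union _ hc.measurableSet
      (ne_top_of_le_ne_top hKf (measure_mono sdiff_subset)) hc.measure_lt_top.ne]
    · have : (K \ Icc (2/3 : ℝ) 1) ∪ ((1 / 3 : ℝ) • (K + K)) ⊆ Icc (2 / 3 * m) (2 / 3) := by
        rintro x (⟨hx, hx'⟩ | hx)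
        · have := hsub hx
          refine ⟨by linarith [this.1], ?_⟩
          by_contra hcon
          exact hx' ⟨by linarith, by linarith [this.2]⟩
        · obtain ⟨_, ⟨a, ha, b, hb, rfl⟩, rfl⟩ := hx
          have h1 := hsub ha
          have h2 := hsub hb
          simp only [smul_eq_mul]
          constructor <;> linarith [h1.1, h1.2, h2.1, h2.2]
      have := measureReal_mono (μ := volume) this (by simp)
      rwa [Real.volume_real_Icc_of_le (by linarith)] at this
    · rw [Set.disjoint_left]
      rintro x ⟨hx, -⟩ ⟨_, ⟨a, ha, b, hb, rfl⟩, rfl⟩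
      apply hsf a ha b hb _ hx
      simp only [smul_eq_mul]; ring
  rcases min_cases (M - m) (2 * volume.real K) with ⟨h1, _⟩ | ⟨h1, _⟩ <;> rw [h1] at hS <;> linarith

/-- **Lemma (Matolcsi–Ruzsa).** If `A` is a measurable 3-sum-free subset of `[0,1]`
with `sup A = 1`, then `μ(A) ≤ 1/3 + μ(A ∩ [2/3,1])/2`. -/
theorem measure_le_third_add_half (A : Set ℝ)
    (hA : A ⊆ Icc (0 : ℝ) 1) (hmeas : MeasurableSet A) (hsup : sSup A = 1)
    (hsf : ∀ x ∈ A, ∀ y ∈ A, ∀ z ∈ A, x + y ≠ 3 * z) :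
    (volume A).toReal ≤ 1 / 3 + (1 / 2) * (volume (A ∩ Icc (2/3 : ℝ) 1)).toReal := by
  have hAf : volume A ≠ ⊤ := ne_top_of_le_ne_top (by simp) (measure_mono hA)
  have hne : A.Nonempty := by
    by_contra h
    rw [Set.not_nonempty_iff_eq_empty] at h
    simp [h] at hsup
  refine le_of_forall_pos_le_add fun e he => ?_
  obtain ⟨K, hKA, hK, hKv⟩ := hmeas.exists_isCompact_lt_add hAf
    (ε := ENNReal.ofReal (e / 2)) (by simpa using he)
  obtain ⟨x, hxA, hx⟩ := exists_lt_of_lt_csSup hne (show 1 - e < sSup A by linarith)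
  have hKf : volume K ≠ ⊤ := hK.measure_lt_top.ne
  have hKv' : volume.real A ≤ volume.real K + e / 2 := by
    have := ENNReal.toReal_mono (by finiteness) hKv.le
    rwa [ENNReal.toReal_add hKf (by finiteness), ENNReal.toReal_ofReal (by linarith)] at this
  have hL : IsCompact (insert x K) := hK.insert x
  have hLA : insert x K ⊆ A := Set.insert_subset hxA hKA
  obtain ⟨m, hm⟩ := hL.exists_isLeast ⟨x, mem_insert _ _⟩
  obtain ⟨M, hM⟩ := hL.exists_isGreatest ⟨x, mem_insert _ _⟩
  have hxM : x ≤ M := hM.2 (mem_insert _ _)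
  have key := aux_compact _ hL m M hm.1 hM.1 (fun y hy => ⟨hm.2 hy, hM.2 hy⟩)
    (hA (hLA hm.1)).1 (hA (hLA hM.1)).2
    (fun a ha b hb c hc => hsf a (hLA ha) b (hLA hb) c (hLA hc))
  have h1 : volume.real K ≤ volume.real (insert x K) :=
    measureReal_mono (subset_insert _ _) hL.measure_lt_top.ne
  have h2 : volume.real (insert x K ∩ Icc (2/3 : ℝ) 1) ≤ volume.real (A ∩ Icc (2/3 : ℝ) 1) :=
    measureReal_mono (inter_subset_inter_left _ hLA)
      (ne_top_of_le_ne_top hAf (measure_mono inter_subset_left))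
  change volume.real A ≤ 1 / 3 + (1 / 2) * volume.real (A ∩ Icc (2/3 : ℝ) 1) + e
  linarith
end

section
/- Let A be a measurable 3-sum-free subset of [0,1] with sup A = 1. Set a = inf A, A₁ = A ∩ [2/3, 1], ε₁ = inf A₁ − 2/3 and ε₂ = (1/3 − ε₁) − μ(A₁). If ε₁ + 2ε₂ ≤ 1/3, then μ(A ∩ [2/9 + a/3, 1]) ≤ 1/3 − ε₁/6 in the case ε₁ ≤ (2/3)a, and μ(A ∩ [2/9 + a/3, 1]) ≤ 1/3 − (1/24)(ε₁ − (2/3)a) in the case ε₁ > (2/3)a. -/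
open MeasureTheory Set

/-- Measure of the part of `A` in `[α, β]`. -/
noncomputable def Fm (A : Set ℝ) (α β : ℝ) : ℝ := (volume (A ∩ Icc α β)).toReal

lemma fin_inter (A : Set ℝ) (α β : ℝ) : volume (A ∩ Icc α β) ≠ ⊤ :=
  measure_ne_top_of_subset inter_subset_right (by simp)

lemma Fm_nonneg (A : Set ℝ) (α β : ℝ) : 0 ≤ Fm A α β := ENNReal.toReal_nonneg

lemma Fm_mono' {A : Set ℝ} {α β γ δ : ℝ} (h : A ∩ Icc α β ⊆ A ∩ Icc γ δ) :
    Fm A α β ≤ Fm A γ δ :=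
  ENNReal.toReal_mono (fin_inter _ _ _) (measure_mono h)

lemma Fm_mono (A : Set ℝ) {α β γ δ : ℝ} (h1 : γ ≤ α) (h2 : β ≤ δ) :
    Fm A α β ≤ Fm A γ δ :=
  Fm_mono' (inter_subset_inter_right _ (Icc_subset_Icc h1 h2))

lemma Fm_add (A : Set ℝ) (α β γ : ℝ) : Fm A α γ ≤ Fm A α β + Fm A β γ := by
  have h : A ∩ Icc α γ ⊆ (A ∩ Icc α β) ∪ (A ∩ Icc β γ) := by
    rintro x ⟨hx, h1, h2⟩
    rcases le_total x β with h | h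
    · exact Or.inl ⟨hx, h1, h⟩
    · exact Or.inr ⟨hx, h, h2⟩
  unfold Fm
  rw [← ENNReal.toReal_add (fin_inter _ _ _) (fin_inter _ _ _)]
  exact ENNReal.toReal_mono (ENNReal.add_ne_top.2 ⟨fin_inter _ _ _, fin_inter _ _ _⟩)
    ((measure_mono h).trans (measure_union_le _ _))

lemma Fm_le (A : Set ℝ) {α β : ℝ} (h : α ≤ β) : Fm A α β ≤ β - α := by
  have := ENNReal.toReal_mono (by simp) (measure_mono (μ := volume) (inter_subset_right : A ∩ Icc α β ⊆ Icc α β))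
  rw [Real.volume_Icc, ENNReal.toReal_ofReal (by linarith)] at this
  exact this

lemma Fm_empty {A : Set ℝ} {α β : ℝ} (h : A ∩ Icc α β = ∅) : Fm A α β = 0 := by
  simp [Fm, h]

/-- The trace at `[α,β]` of the dilated set. -/
lemma scale_s9 (A : Set ℝ) (p α β : ℝ) :
    (volume ({y : ℝ | (y + p) / 3 ∈ A} ∩ Icc α β)).toReal
      = 3 * Fm A ((α + p) / 3) ((β + p) / 3) := by
  have : {y : ℝ | (y + p) / 3 ∈ A} ∩ Icc α β
      = (fun y => y + p) ⁻¹' (((1/3 : ℝ) * ·) ⁻¹' (A ∩ Icc ((α + p) / 3) ((β + p) / 3))) := by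
    ext y
    simp only [mem_inter_iff, mem_ofPred_eq, mem_preimage, mem_Icc]
    have : (1/3 : ℝ) * (y + p) = (y + p) / 3 := by ring
    rw [this]
    constructor
    · rintro ⟨h, h1, h2⟩
      exact ⟨h, by linarith, by linarith⟩
    · rintro ⟨h, h1, h2⟩
      exact ⟨h, by linarith, by linarith⟩
  rw [this, measure_preimage_add_right, Real.volume_preimage_mul_left (by norm_num)]
  simp [Fm]

lemma scale_meas {A : Set ℝ} (hm : MeasurableSet A) (p : ℝ) :
    MeasurableSet {y : ℝ | (y + p) / 3 ∈ A} := by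
  have : Measurable (fun y : ℝ => (y + p) / 3) := by fun_prop
  exact this hm

open scoped symmDiff Topology in
lemma null_closure {A : Set ℝ} (hA : A ⊆ Icc (0 : ℝ) 1) (hm : MeasurableSet A)
    (hsf : ∀ x ∈ A, ∀ y ∈ A, ∀ z ∈ A, x + y ≠ 3 * z) {p : ℝ} (hp : p ∈ closure A) :
    volume ({y : ℝ | (y + p) / 3 ∈ A} ∩ A) = 0 := by
  let f : C(ℝ, C(ℝ, ℝ)) := ContinuousMap.curry ⟨fun q : ℝ × ℝ => q.2 + q.1, by fun_prop⟩
  have hf : ∀ p : ℝ, MeasurePreserving (f p) volume volume :=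
    fun p => measurePreserving_add_right volume p
  let s : Set ℝ := {x | x / 3 ∈ A}
  have hs : MeasurableSet s := by
    have : Measurable (fun y : ℝ => y / 3) := by fun_prop
    exact this hm
  have hsfin : volume s ≠ ⊤ := by
    have hfin : volume (Icc (0:ℝ) 3) ≠ ⊤ := by simp
    refine measure_ne_top_of_subset ?_ hfin
    intro x hx
    have := hA hx
    exact ⟨by linarith [this.1], by linarith [this.2]⟩
  have key := tendsto_measure_symmDiff_preimage_nhds_zero (μ := volume) (ν := volume)
    (f.continuous.tendsto p) (.of_forall hf) (hf p) hs.nullMeasurableSet hsfin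
  have hq : ∀ q ∈ A, volume ({y : ℝ | (y + p) / 3 ∈ A} ∩ A) ≤
      volume ((f q ⁻¹' s) ∆ (f p ⁻¹' s)) := by
    intro q hq
    apply measure_mono
    rintro y ⟨h1, h2⟩
    refine Or.inr ⟨h1, fun h3 => ?_⟩
    have h3 : (y + q) / 3 ∈ A := h3
    exact hsf y h2 q hq _ h3 (by ring)
  have h2 := key.mono_left (nhdsWithin_le_nhds (s := A))
  have : (𝓝[A] p).NeBot := mem_closure_iff_nhdsWithin_neBot.1 hp
  exact le_antisymm (ge_of_tendsto h2 (Filter.eventually_of_mem self_mem_nhdsWithin hq)) bot_le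

lemma J {A : Set ℝ} (hA : A ⊆ Icc (0 : ℝ) 1) (hm : MeasurableSet A)
    (hsf : ∀ x ∈ A, ∀ y ∈ A, ∀ z ∈ A, x + y ≠ 3 * z) {p : ℝ} (hp : p ∈ closure A)
    {α β : ℝ} (h : α ≤ β) :
    3 * Fm A ((α + p) / 3) ((β + p) / 3) + Fm A α β ≤ β - α := by
  rw [← scale_s9]
  have hd : AEDisjoint volume ({y : ℝ | (y + p) / 3 ∈ A} ∩ Icc α β) (A ∩ Icc α β) := by
    refine measure_mono_null ?_ (null_closure hA hm hsf hp)
    rintro y ⟨⟨h1, _⟩, h2, _⟩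
    exact ⟨h1, h2⟩
  have := measureReal_union₀ (hm.inter measurableSet_Icc).nullMeasurableSet hd
    (fin_inter _ _ _) (fin_inter _ _ _)
  unfold Fm
  change volume.real _ + volume.real _ ≤ _
  rw [← this, ← Real.volume_real_Icc_of_le h]
  exact measureReal_mono (by
    rintro y (h | h)
    · exact h.2
    · exact h.2) (by simp)

lemma refl_le {A : Set ℝ} (hm : MeasurableSet A)
    (hsf : ∀ x ∈ A, ∀ y ∈ A, ∀ z ∈ A, x + y ≠ 3 * z) {α β : ℝ} (h : α ≤ β)
    (hz : (α + β) / 3 ∈ A) : 2 * Fm A α β ≤ β - α := by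
  have hmI : MeasurableSet (A ∩ Icc α β) := hm.inter measurableSet_Icc
  have e : volume ((fun y => (α + β) - y) ⁻¹' (A ∩ Icc α β)) = volume (A ∩ Icc α β) :=
    (Measure.measurePreserving_sub_left volume (α + β)).measure_preimage hmI.nullMeasurableSet
  have hd : Disjoint ((fun y => (α + β) - y) ⁻¹' (A ∩ Icc α β)) (A ∩ Icc α β) := by
    rw [Set.disjoint_left]
    rintro y ⟨h1, _⟩ ⟨h2, _⟩
    exact hsf _ h1 _ h2 _ hz (by ring)
  have := measureReal_union (μ := volume) hd hmI (by rw [e]; exact fin_inter _ _ _) (fin_inter _ _ _)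
  have e2 : volume.real ((fun y => (α + β) - y) ⁻¹' (A ∩ Icc α β)) = Fm A α β := by
    unfold Fm Measure.real; rw [e]
  have e3 : volume.real (A ∩ Icc α β) = Fm A α β := rfl
  rw [e2, e3] at this
  have h3 : volume.real ((fun y => (α + β) - y) ⁻¹' (A ∩ Icc α β) ∪ A ∩ Icc α β) ≤
      volume.real (Icc α β) := by
    apply measureReal_mono _ (by simp)
    rintro y (⟨_, h1, h2⟩ | h)
    · exact ⟨by linarith, by linarith⟩
    · exact h.2
  rw [Real.volume_real_Icc_of_le h] at h3
  linarith

open scoped Topology in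
lemma null_of_half (E : Set ℝ)
    (h : ∀ y ∈ E, ∀ y' ∈ E, y ≤ y' → 2 * Fm E y y' ≤ y' - y) : volume E = 0 := by
  by_contra hne
  have hR : ∀ x ∈ E, ∀ r > 0, Fm E x (x + r) ≤ 3 * r / 4 := by
    intro x hx r hr
    have hne : (E ∩ Icc x (x + r)).Nonempty := ⟨x, hx, le_rfl, by linarith⟩
    have hb : BddAbove (E ∩ Icc x (x + r)) := ⟨x + r, fun y hy => hy.2.2⟩
    obtain ⟨y, hy, hlt⟩ := exists_lt_of_lt_csSup hne
      (show sSup (E ∩ Icc x (x + r)) - r / 4 < sSup (E ∩ Icc x (x + r)) by linarith)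
    have h1 := h x hx y hy.1 hy.2.1
    have h2 : Fm E x (x + r) ≤ Fm E x (y + r / 4) := Fm_mono' (by
      intro z hz
      exact ⟨hz.1, hz.2.1, by linarith [le_csSup hb hz]⟩)
    have h3 := Fm_add E x y (y + r / 4)
    have h4 := Fm_le E (show y ≤ y + r / 4 by linarith)
    linarith [hy.2.2]
  have hL : ∀ x ∈ E, ∀ r > 0, Fm E (x - r) x ≤ 3 * r / 4 := by
    intro x hx r hr
    have hne : (E ∩ Icc (x - r) x).Nonempty := ⟨x, hx, by linarith, le_rfl⟩
    have hb : BddBelow (E ∩ Icc (x - r) x) := ⟨x - r, fun y hy => hy.2.1⟩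
    obtain ⟨y, hy, hlt⟩ := exists_lt_of_csInf_lt hne
      (show sInf (E ∩ Icc (x - r) x) < sInf (E ∩ Icc (x - r) x) + r / 4 by linarith)
    have h1 := h y hy.1 x hx hy.2.2
    have h2 : Fm E (x - r) x ≤ Fm E (y - r / 4) x := Fm_mono' (by
      intro z hz
      exact ⟨hz.1, by linarith [csInf_le hb hz], hz.2.2⟩)
    have h3 := Fm_add E (y - r / 4) y x
    have h4 := Fm_le E (show y - r / 4 ≤ y by linarith)
    linarith [hy.2.1]
  have hd := Besicovitch.ae_tendsto_measure_inter_div volume E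
  have hd2 : ∃ x ∈ E, Filter.Tendsto (fun r => volume (E ∩ Metric.closedBall x r) /
      volume (Metric.closedBall x r)) (𝓝[>] 0) (𝓝 1) := by
    by_contra hcon
    push Not at hcon
    have h0 : volume.restrict E E = 0 := measure_mono_null (fun x hx => hcon x hx) hd
    exact hne (by rwa [Measure.restrict_apply_self] at h0)
  obtain ⟨x, hx, ht⟩ := hd2
  have hle : ∀ᶠ r in 𝓝[>] (0:ℝ), volume (E ∩ Metric.closedBall x r) /
      volume (Metric.closedBall x r) ≤ ENNReal.ofReal (3 / 4) := by
    filter_upwards [self_mem_nhdsWithin] with r hr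
    have hr : 0 < r := hr
    rw [Real.closedBall_eq_Icc, Real.volume_Icc]
    apply ENNReal.div_le_of_le_mul
    rw [← ENNReal.ofReal_mul (by norm_num), ← ENNReal.ofReal_toReal (fin_inter _ _ _)]
    apply ENNReal.ofReal_le_ofReal
    have := Fm_add E (x - r) x (x + r)
    have h1 := hR x hx r hr
    have h2 := hL x hx r hr
    change Fm E (x - r) (x + r) ≤ _
    linarith
  have := le_of_tendsto ht hle
  rw [← ENNReal.ofReal_one, ENNReal.ofReal_le_ofReal_iff (by norm_num)] at this
  norm_num at this

lemma Cbound {A : Set ℝ} (hA : A ⊆ Icc (0 : ℝ) 1) (hm : MeasurableSet A)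
    (hsf : ∀ x ∈ A, ∀ y ∈ A, ∀ z ∈ A, x + y ≠ 3 * z) {b c : ℝ} (hb : b ∈ closure A)
    (hc : c ∈ closure A) (hbc : b ≤ c) (h2 : c - b ≤ 2 * Fm A b c) :
    3 * Fm A (2 * b / 3) (2 * c / 3) + Fm A b c ≤ c - b := by
  set F := {y : ℝ | (y + b) / 3 ∈ A} ∩ Icc b c with hF
  set G := {y : ℝ | (y + c) / 3 ∈ A} ∩ Icc b c with hG
  have hFm : MeasurableSet F := (scale_meas hm b).inter measurableSet_Icc
  have hGm : MeasurableSet G := (scale_meas hm c).inter measurableSet_Icc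
  have hFA : volume (F ∩ A) = 0 := by
    refine measure_mono_null ?_ (null_closure hA hm hsf hb)
    rintro y ⟨⟨h1, _⟩, h2⟩
    exact ⟨h1, h2⟩
  have hGA : volume (G ∩ A) = 0 := by
    refine measure_mono_null ?_ (null_closure hA hm hsf hc)
    rintro y ⟨⟨h1, _⟩, h2⟩
    exact ⟨h1, h2⟩
  have hFG : volume (F ∩ G) = 0 := by
    apply null_of_half
    rintro y ⟨⟨hyb, hyI⟩, ⟨hyc, _⟩⟩ y' ⟨⟨hyb', hyI'⟩, ⟨hyc', _⟩⟩ hyy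
    have k1 := refl_le hm hsf hyI.1 (by rw [add_comm]; exact hyb)
    have k2 := refl_le hm hsf hyI'.2 hyc'
    have k3 := Fm_add A b y c
    have k4 := Fm_add A y y' c
    have hd : AEDisjoint volume ((F ∩ G) ∩ Icc y y') (A ∩ Icc y y') := by
      refine measure_mono_null ?_ hFA
      rintro t ⟨⟨⟨h1, _⟩, _⟩, h2, _⟩
      exact ⟨h1, h2⟩
    have := measureReal_union₀ (hm.inter measurableSet_Icc).nullMeasurableSet hd
      (fin_inter _ _ _) (fin_inter _ _ _)
    have h5 : volume.real ((F ∩ G) ∩ Icc y y' ∪ A ∩ Icc y y') ≤ volume.real (Icc y y') := by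
      apply measureReal_mono _ (by simp)
      rintro y (h | h)
      · exact h.2
      · exact h.2
    rw [Real.volume_real_Icc_of_le hyy] at h5
    change _ = Fm (F ∩ G) y y' + Fm A y y' at this
    linarith
  have hFf : volume F ≠ ⊤ := fin_inter _ _ _
  have hGf : volume G ≠ ⊤ := fin_inter _ _ _
  have u1 : volume.real (F ∪ G) = volume.real F + volume.real G :=
    measureReal_union₀ hGm.nullMeasurableSet hFG hFf hGf
  have u2 : volume.real ((F ∪ G) ∪ (A ∩ Icc b c)) =
      volume.real (F ∪ G) + volume.real (A ∩ Icc b c) := by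
    apply measureReal_union₀ (hm.inter measurableSet_Icc).nullMeasurableSet _
      (measure_union_ne_top hFf hGf) (fin_inter _ _ _)
    refine measure_mono_null ?_ (measure_union_null hFA hGA)
    rintro y ⟨h | h, h', _⟩
    · exact Or.inl ⟨h, h'⟩
    · exact Or.inr ⟨h, h'⟩
  have u3 : volume.real ((F ∪ G) ∪ (A ∩ Icc b c)) ≤ volume.real (Icc b c) := by
    apply measureReal_mono _ (by simp)
    rintro y ((h | h) | h)
    · exact h.2
    · exact h.2
    · exact h.2
  rw [Real.volume_real_Icc_of_le hbc] at u3
  have s1 : volume.real F = _ := scale_s9 A b b c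
  have s2 : volume.real G = _ := scale_s9 A c b c
  have s3 : volume.real (A ∩ Icc b c) = Fm A b c := rfl
  have k := Fm_add A (2 * b / 3) ((c + b) / 3) (2 * c / 3)
  have e1 : (b + b) / 3 = 2 * b / 3 := by ring
  have e2 : (c + c) / 3 = 2 * c / 3 := by ring
  have e3 : (b + c) / 3 = (c + b) / 3 := by ring
  rw [e1] at s1
  rw [e2, e3] at s2
  linarith

/-- Bound on `[e, 2b/3]`. -/
lemma Mbound {A : Set ℝ} (hA : A ⊆ Icc (0 : ℝ) 1) (hm : MeasurableSet A)
    (hsf : ∀ x ∈ A, ∀ y ∈ A, ∀ z ∈ A, x + y ≠ 3 * z) {b e g k : ℝ} (hb : b ≤ 1)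
    (he : b / 2 ≤ e) (hk : 0 ≤ k) (hk2 : g - (1 + e) / 3 ≤ k) :
    Fm A e g ≤ (1 - b - Fm A b 1) / 3 + k := by
  have hle := Fm_le A hb
  rcases (A ∩ Icc e g).eq_empty_or_nonempty with h0 | hne
  · rw [Fm_empty h0]; linarith
  have hbd : BddBelow (A ∩ Icc e g) := ⟨e, fun y hy => hy.2.1⟩
  set w := sInf (A ∩ Icc e g) with hw
  have hwe : e ≤ w := le_csInf hne fun y hy => hy.2.1
  have hwc : w ∈ closure A :=
    closure_mono inter_subset_left (csInf_mem_closure hne hbd)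
  have h1 := J hA hm hsf hwc hb
  have h2 : Fm A e g ≤ Fm A w g := Fm_mono' fun y hy => ⟨hy.1, csInf_le hbd hy, hy.2.2⟩
  have h3 := Fm_add A w ((1 + w) / 3) g
  have h4 : Fm A w ((1 + w) / 3) ≤ Fm A ((b + w) / 3) ((1 + w) / 3) :=
    Fm_mono A (by linarith) le_rfl
  have h5 : Fm A ((1 + w) / 3) g ≤ k := by
    rcases le_total ((1 + w) / 3) g with h | h
    · have := Fm_le A h
      linarith
    · have := Fm_mono A h (le_refl g)
      have := Fm_le A (le_refl g)
      linarith
  linarith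

/-- Trade-off between the parts near `u` and near `2u/3`. -/
lemma Lbound {A : Set ℝ} (hA : A ⊆ Icc (0 : ℝ) 1) (hm : MeasurableSet A)
    (hsf : ∀ x ∈ A, ∀ y ∈ A, ∀ z ∈ A, x + y ≠ 3 * z) {u e l r : ℝ}
    (h1 : 2 * u / 3 ≤ l) (h2 : 2 * e / 3 ≤ r) (h3 : l ≤ r) :
    3 * Fm A l r + 2 * Fm A u e ≤ 3 * r - 2 * u := by
  rcases (A ∩ Icc u e).eq_empty_or_nonempty with h0 | hne
  · rw [Fm_empty h0]
    have := Fm_le A h3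
    linarith
  have hbb : BddBelow (A ∩ Icc u e) := ⟨u, fun y hy => hy.2.1⟩
  have hba : BddAbove (A ∩ Icc u e) := ⟨e, fun y hy => hy.2.2⟩
  set v := sInf (A ∩ Icc u e) with hv
  set w := sSup (A ∩ Icc u e) with hw
  have hvu : u ≤ v := le_csInf hne fun y hy => hy.2.1
  have hwe : w ≤ e := csSup_le hne fun y hy => hy.2.2
  have hvw : v ≤ w := csInf_le_csSup hne hbb hba
  have hvc : v ∈ closure A := closure_mono inter_subset_left (csInf_mem_closure hne hbb)
  have hwc : w ∈ closure A := closure_mono inter_subset_left (csSup_mem_closure hne hba)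
  have hV : Fm A u e ≤ Fm A v w :=
    Fm_mono' fun y hy => ⟨hy.1, csInf_le hbb hy, le_csSup hba hy⟩
  have j1 := J hA hm hsf hvc hvw
  have j2 := J hA hm hsf hwc hvw
  have e3 : (v + w) / 3 = (w + v) / 3 := by ring
  rw [e3] at j2
  have k0 : Fm A l r ≤ Fm A (2 * u / 3) r := Fm_mono A h1 le_rfl
  have k1 := Fm_add A (2 * u / 3) ((v + v) / 3) r
  have k2 := Fm_add A ((v + v) / 3) ((w + v) / 3) r
  have k3 := Fm_add A ((w + v) / 3) ((w + w) / 3) r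
  have k4 := Fm_le A (show 2 * u / 3 ≤ (v + v) / 3 by linarith)
  have k5 := Fm_le A (show (w + w) / 3 ≤ r by linarith)
  linarith

theorem central_lemma (A : Set ℝ)
    (hA : A ⊆ Icc (0 : ℝ) 1) (hmeas : MeasurableSet A) (hsup : sSup A = 1)
    (hsf : ∀ x ∈ A, ∀ y ∈ A, ∀ z ∈ A, x + y ≠ 3 * z)
    (a ε₁ ε₂ : ℝ) (ha : a = sInf A)
    (hε₁ : ε₁ = sInf (A ∩ Icc (2/3 : ℝ) 1) - 2/3)
    (hε₂ : ε₂ = (1/3 - ε₁) - (volume (A ∩ Icc (2/3 : ℝ) 1)).toReal)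
    (hcond : ε₁ + 2 * ε₂ ≤ 1/3) :
    (ε₁ ≤ 2/3 * a →
      (volume (A ∩ Icc (2/9 + a/3 : ℝ) 1)).toReal ≤ 1/3 - ε₁/6) ∧
    (ε₁ > 2/3 * a →
      (volume (A ∩ Icc (2/9 + a/3 : ℝ) 1)).toReal ≤ 1/3 - (1/24) * (ε₁ - 2/3 * a)) := by
  have hne : A.Nonempty := by
    rcases A.eq_empty_or_nonempty with h | h
    · rw [h, Real.sSup_empty] at hsup; norm_num at hsup
    · exact h
  have hbb : BddBelow A := ⟨0, fun y hy => (hA hy).1⟩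
  have hba : BddAbove A := ⟨1, fun y hy => (hA hy).2⟩
  have h1c : (1 : ℝ) ∈ closure A := hsup ▸ csSup_mem_closure hne hba
  have hac : a ∈ closure A := ha ▸ csInf_mem_closure hne hbb
  have ha0 : 0 ≤ a := ha ▸ le_csInf hne fun y hy => (hA hy).1
  obtain ⟨t, htA, ht⟩ := exists_lt_of_lt_csSup hne (show (2/3 : ℝ) < sSup A by rw [hsup]; norm_num)
  have hne1 : (A ∩ Icc (2/3 : ℝ) 1).Nonempty := ⟨t, htA, ht.le, (hA htA).2⟩
  have hbb1 : BddBelow (A ∩ Icc (2/3 : ℝ) 1) := ⟨2/3, fun y hy => hy.2.1⟩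
  obtain ⟨b, hb⟩ : ∃ b, b = sInf (A ∩ Icc (2/3 : ℝ) 1) := ⟨_, rfl⟩
  have hbc : b ∈ closure A := by
    rw [hb]; exact closure_mono inter_subset_left (csInf_mem_closure hne1 hbb1)
  have hb23 : 2/3 ≤ b := by rw [hb]; exact le_csInf hne1 fun y hy => hy.2.1
  have hb1 : b ≤ 1 := by
    rw [hb]; exact (csInf_le hbb1 ⟨htA, ht.le, (hA htA).2⟩).trans (hA htA).2
  rw [← hb] at hε₁
  have hA1 : Fm A (2/3) 1 ≤ Fm A b 1 :=
    Fm_mono' fun y hy => ⟨hy.1, by rw [hb]; exact csInf_le hbb1 hy, hy.2.2⟩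
  have hA2 : Fm A b 1 ≤ Fm A (2/3) 1 := Fm_mono A hb23 le_rfl
  have hε₂ : ε₂ = (1/3 - ε₁) - Fm A (2/3) 1 := hε₂
  change (_ → Fm A (2/9 + a/3) 1 ≤ _) ∧ (_ → Fm A (2/9 + a/3) 1 ≤ _)
  have hm1 : Fm A b 1 = 1 - b - ε₂ := by linarith
  have hC := Cbound hA hmeas hsf hbc h1c hb1 (by linarith)
  have hL := J hA hmeas hsf hac hb1
  have c1 := Fm_add A (2/9 + a/3) ((b + a) / 3) 1
  have c2 := Fm_add A ((b + a) / 3) ((1 + a) / 3) 1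
  have c4 := Fm_add A (2 * b / 3) (2 * 1 / 3) 1
  have c5 : Fm A (2 * 1 / 3) 1 = Fm A (2/3) 1 := by norm_num
  constructor
  · intro hcase
    have c3 := Fm_add A ((1 + a) / 3) (2 * b / 3) 1
    have hL0 := Fm_le A (show 2/9 + a/3 ≤ (b + a) / 3 by linarith)
    have hM := Mbound hA hmeas hsf (b := b) (e := (1 + a) / 3) (g := 2 * b / 3) (k := ε₁ / 2)
      hb1 (by linarith) (by linarith) (by linarith)
    linarith
  · intro hcase
    have c3 := Fm_add A ((1 + a) / 3) (b / 2) 1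
    have c6 := Fm_add A (b / 2) (2 * b / 3) 1
    have hM := Mbound hA hmeas hsf (b := b) (e := b / 2) (g := 2 * b / 3) (k := ε₁ / 2)
      hb1 (by linarith) (by linarith) (by linarith)
    have hL0 := Lbound hA hmeas hsf (u := (1 + a) / 3) (e := b / 2) (l := 2/9 + a/3)
      (r := (b + a) / 3) (by linarith) (by linarith) (by linarith)
    have hub : (1 + a) / 3 ≤ b / 2 := by linarith
    have hV := J hA hmeas hsf hbc hub
    have v1 := Fm_add A ((1 + a) / 3) (((1 + a) / 3 + b) / 3) (b / 2)
    have v2 := Fm_le A (show (1 + a) / 3 ≤ ((1 + a) / 3 + b) / 3 by linarith)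
    have v3 : (b / 2 + b) / 3 = b / 2 := by ring
    rw [v3] at hV
    linarith
end
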